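/- Let q = p^m and suppose n divides q − 1 and for every proper divisor ν of m, gcd(n, (p^m − 1)/(p^ν − 1)) ≪ n^δ q^{1−δ}/p^ν with δ = 119/605. Then for any nontrivial additive character ψ of 𝔽_q, |Σ_{x ∈ 𝔽_q} ψ(x^n)| ≪ q^{(7 − 2δ₂)/8} · n^{(2 + 2δ₂)/8}, where δ₂ = 1/56 + o(1). -/

import Mathlib

set_option linter.unusedSectionVars false
set_option linter.unusedVariables false
open Pointwise

namespace GaussAux

variable {F : Type} [Field F] [Fintype F] [DecidableEq F]

/-- A finite multiplicative subgroup of the units of a field, as a finset. -/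
structure IsGrp (H : Finset F) : Prop where
  one_mem : (1 : F) ∈ H
  zero_notMem : (0 : F) ∉ H
  mul_mem : ∀ a ∈ H, ∀ b ∈ H, a * b ∈ H
  inv_mem : ∀ a ∈ H, a⁻¹ ∈ H

theorem IsGrp.ne_zero {H : Finset F} (hH : IsGrp H) {a : F} (ha : a ∈ H) : a ≠ 0 := by
  rintro rfl
  exact hH.zero_notMem ha

/-- The subgroup character sum. -/
noncomputable def S (ψ : AddChar F ℂ) (H : Finset F) (t : F) : ℂ := ∑ h ∈ H, ψ (t * h)

variable (ψ : AddChar F ℂ) (H : Finset F)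

theorem sum_dilate (hH : IsGrp H) {M : Type*} [AddCommMonoid M] {k : F} (hk : k ∈ H) (f : F → M) :
    ∑ h ∈ H, f (k * h) = ∑ h ∈ H, f h := by
  have hk0 := hH.ne_zero hk
  refine Finset.sum_nbij' (fun h => k * h) (fun h => k⁻¹ * h) ?_ ?_ ?_ ?_ ?_
  · intro a ha; exact hH.mul_mem _ hk _ ha
  · intro a ha; exact hH.mul_mem _ (hH.inv_mem _ hk) _ ha
  · intro a _; field_simp
  · intro a _; field_simp
  · intro a _; rfl

theorem S_dilate (hH : IsGrp H) {k : F} (hk : k ∈ H) (t : F) : S ψ H (k * t) = S ψ H t := by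
  unfold S
  rw [← sum_dilate H hH hk (fun h => ψ (t * h))]
  refine Finset.sum_congr rfl fun h _ => ?_
  congr 1; ring

theorem S_neg (t : F) : S ψ H (-t) = (starRingEnd ℂ) (S ψ H t) := by
  unfold S
  rw [map_sum]
  refine Finset.sum_congr rfl fun h _ => ?_
  rw [neg_mul, AddChar.map_neg_eq_conj]

theorem norm_S_neg (t : F) : ‖S ψ H (-t)‖ = ‖S ψ H t‖ := by
  rw [S_neg, RCLike.norm_conj]

theorem S_zero : S ψ H 0 = (H.card : ℂ) := by
  simp [S]

theorem norm_S_le (t : F) : ‖S ψ H t‖ ≤ (H.card : ℝ) := by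
  unfold S
  refine (norm_sum_le _ _).trans ?_
  simp [AddChar.norm_apply]

theorem spherical (hH : IsGrp H) (x y : F) :
    ∑ h ∈ H, S ψ H (x + h * y) = S ψ H x * S ψ H y := by
  have h1 : ∀ h, S ψ H (x + h * y) = ∑ k ∈ H, ψ (x * k) * ψ (h * y * k) := by
    intro h
    unfold S
    refine Finset.sum_congr rfl fun k _ => ?_
    rw [add_mul, AddChar.map_add_eq_mul]
  simp_rw [h1]
  rw [Finset.sum_comm]
  have h2 : S ψ H x * S ψ H y = ∑ k ∈ H, ψ (x * k) * S ψ H y := by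
    unfold S; rw [Finset.sum_mul]
  rw [h2]
  refine Finset.sum_congr rfl fun k hk => ?_
  rw [← Finset.mul_sum, ← S_dilate ψ H hH hk y]
  congr 1
  unfold S
  refine Finset.sum_congr rfl fun h _ => ?_
  congr 1; ring

theorem orth (hψ : ψ ≠ 1) (x : F) :
    ∑ t : F, ψ (t * x) = if x = 0 then (Fintype.card F : ℂ) else 0 := by
  have := AddChar.sum_mulShift x (AddChar.IsPrimitive.of_ne_one hψ)
  rw [this]
  split_ifs <;> simp

theorem norm_sq_S (t : F) :
    ((‖S ψ H t‖ ^ 2 : ℝ) : ℂ) = ∑ a ∈ H, ∑ b ∈ H, ψ (t * (a - b)) := by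
  have h1 : ((‖S ψ H t‖ ^ 2 : ℝ) : ℂ) = S ψ H t * S ψ H (-t) := by
    rw [S_neg, RCLike.mul_conj]; push_cast; rfl
  rw [h1]
  unfold S
  rw [Finset.sum_mul_sum]
  refine Finset.sum_congr rfl fun a _ => Finset.sum_congr rfl fun b _ => ?_
  rw [← AddChar.map_add_eq_mul]
  congr 1; ring

/-- quadruples `((a,a'),(b,b'))` with `a - a' + ξ (b - b') = 0`. -/
def coll (H : Finset F) (ξ : F) : Finset ((F × F) × (F × F)) :=
  ((H ×ˢ H) ×ˢ (H ×ˢ H)).filter fun x => x.1.1 - x.1.2 + ξ * (x.2.1 - x.2.2) = 0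

theorem smooth (hψ : ψ ≠ 1) (w t : F) :
    ((∑ k ∈ H, ‖S ψ H (t + k * w)‖ ^ 2 : ℝ) : ℂ) =
      ∑ x ∈ H ×ˢ H, ψ (t * (x.1 - x.2)) * S ψ H (w * (x.1 - x.2)) := by
  push_cast
  have h1 : ∀ k, ((‖S ψ H (t + k * w)‖ : ℂ) ^ 2) =
      ∑ x ∈ H ×ˢ H, ψ (t * (x.1 - x.2)) * ψ (w * (x.1 - x.2) * k) := by
    intro k
    have := norm_sq_S ψ H (t + k * w)
    push_cast at this
    rw [this, Finset.sum_product]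
    refine Finset.sum_congr rfl fun a _ => Finset.sum_congr rfl fun b _ => ?_
    rw [← AddChar.map_add_eq_mul]
    congr 1; ring
  simp_rw [h1]
  rw [Finset.sum_comm]
  refine Finset.sum_congr rfl fun x _ => ?_
  rw [← Finset.mul_sum]; rfl

theorem coll_identity (hψ : ψ ≠ 1) (w z ξ : F) :
    ((∑ t : F, (∑ k ∈ H, ‖S ψ H (t + k * w)‖ ^ 2) * (∑ k ∈ H, ‖S ψ H (ξ * t + k * z)‖ ^ 2) : ℝ) : ℂ)
      = Fintype.card F * ∑ x ∈ coll H ξ, S ψ H (w * (x.1.1 - x.1.2)) * S ψ H (z * (x.2.1 - x.2.2)) := by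
  rw [Complex.ofReal_sum]
  have h0 : ∀ t : F, (((∑ k ∈ H, ‖S ψ H (t + k * w)‖ ^ 2) *
      (∑ k ∈ H, ‖S ψ H (ξ * t + k * z)‖ ^ 2) : ℝ) : ℂ) =
      ∑ x ∈ (H ×ˢ H) ×ˢ (H ×ˢ H), ψ (t * (x.1.1 - x.1.2)) * S ψ H (w * (x.1.1 - x.1.2)) *
      (ψ (ξ * t * (x.2.1 - x.2.2)) * S ψ H (z * (x.2.1 - x.2.2))) := by
    intro t
    rw [Complex.ofReal_mul, smooth ψ H hψ, smooth ψ H hψ, Finset.sum_mul_sum,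
      Finset.sum_product (H ×ˢ H) (H ×ˢ H)]
  rw [Finset.sum_congr rfl fun t _ => h0 t]
  rw [Finset.sum_comm, coll, Finset.sum_filter, Finset.mul_sum]
  refine Finset.sum_congr rfl fun x _ => ?_
  have h1 : ∀ t : F, ψ (t * (x.1.1 - x.1.2)) * S ψ H (w * (x.1.1 - x.1.2)) *
      (ψ (ξ * t * (x.2.1 - x.2.2)) * S ψ H (z * (x.2.1 - x.2.2))) =
      ψ (t * (x.1.1 - x.1.2 + ξ * (x.2.1 - x.2.2))) *
        (S ψ H (w * (x.1.1 - x.1.2)) * S ψ H (z * (x.2.1 - x.2.2))) := by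
    intro t
    have : t * (x.1.1 - x.1.2 + ξ * (x.2.1 - x.2.2)) =
      t * (x.1.1 - x.1.2) + ξ * t * (x.2.1 - x.2.2) := by ring
    rw [this, AddChar.map_add_eq_mul]; ring
  simp_rw [h1]
  rw [← Finset.sum_mul, orth ψ hψ]
  split_ifs <;> simp

theorem parseval (hψ : ψ ≠ 1) : ∑ t : F, ‖S ψ H t‖ ^ 2 = Fintype.card F * (H.card : ℝ) := by
  have h : ((∑ t : F, ‖S ψ H t‖ ^ 2 : ℝ) : ℂ) = ((Fintype.card F * (H.card : ℝ) : ℝ) : ℂ) := by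
    rw [Complex.ofReal_sum]
    simp_rw [norm_sq_S]
    rw [Finset.sum_comm]
    have : ∀ a ∈ H, ∑ t : F, ∑ b ∈ H, ψ (t * (a - b)) = (Fintype.card F : ℂ) := by
      intro a ha
      rw [Finset.sum_comm]
      simp_rw [orth ψ hψ, sub_eq_zero]
      simp [ha]
    rw [Finset.sum_congr rfl this]
    simp [mul_comm]
  exact_mod_cast h

theorem parseval_mul (hψ : ψ ≠ 1) {ξ : F} (hξ : ξ ≠ 0) :
    ∑ t : F, ‖S ψ H (ξ * t)‖ ^ 2 = Fintype.card F * (H.card : ℝ) := by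
  rw [← parseval ψ H hψ]
  exact Fintype.sum_equiv (Equiv.mulLeft₀ ξ hξ) _ _ (fun t => rfl)

/-- `q E(ξ)`. -/
theorem coll_card (hψ : ψ ≠ 1) (hH : IsGrp H) (ξ : F) :
    ∑ t : F, ‖S ψ H t‖ ^ 2 * ‖S ψ H (ξ * t)‖ ^ 2 = Fintype.card F * ((coll H ξ).card : ℝ) := by
  have h := coll_identity ψ H hψ 0 0 ξ
  simp only [mul_zero, add_zero, zero_mul, S_zero, Finset.sum_const, nsmul_eq_mul] at h
  have h' : (∑ t : F, ((H.card : ℝ) * ‖S ψ H t‖ ^ 2) * ((H.card : ℝ) * ‖S ψ H (ξ * t)‖ ^ 2)) =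
    Fintype.card F * (((coll H ξ).card : ℝ) * ((H.card : ℝ) * (H.card : ℝ))) := by exact_mod_cast h
  have hN : (H.card : ℝ) ≠ 0 := by
    have : 0 < H.card := Finset.card_pos.mpr ⟨1, hH.one_mem⟩
    positivity
  have h2 : (∑ t : F, ((H.card : ℝ) * ‖S ψ H t‖ ^ 2) * ((H.card : ℝ) * ‖S ψ H (ξ * t)‖ ^ 2)) =
    (H.card : ℝ) ^ 2 * ∑ t : F, ‖S ψ H t‖ ^ 2 * ‖S ψ H (ξ * t)‖ ^ 2 := by
    rw [Finset.mul_sum]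
    refine Finset.sum_congr rfl fun t _ => by ring
  rw [h2] at h'
  have hN2 : (H.card : ℝ) ^ 2 ≠ 0 := pow_ne_zero _ hN
  apply mul_left_cancel₀ hN2
  rw [h']; ring

theorem smooth_lower (hH : IsGrp H) (w t : F) :
    ‖S ψ H t‖ ^ 2 * ‖S ψ H w‖ ^ 2 ≤ H.card * ∑ k ∈ H, ‖S ψ H (t + k * w)‖ ^ 2 := by
  rw [← mul_pow, ← norm_mul, ← spherical ψ H hH t w]
  calc _ ≤ (∑ k ∈ H, ‖S ψ H (t + k * w)‖) ^ 2 := by gcongr; exact norm_sum_le _ _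
    _ ≤ _ := sq_sum_le_card_mul_sum_sq

theorem gap_arith {N q ρ E Dg L : ℝ} (hN : 0 < N) (hq : 0 < q) (hρ0 : 0 < ρ) (hD : 0 < Dg)
    (hD1 : Dg ≤ N ^ 2) (hlow : ρ * (2 * N ^ 2) * (q * E) ≤ N ^ 2 * L)
    (hup : L ≤ q * (ρ * E - ρ * Dg + Dg * N ^ 2)) (hE : 2 * N ^ 6 ≤ E * (ρ * (2 * N ^ 2))) :
    False := by
  have hN2 : 0 < N ^ 2 := by positivity
  have h5 : ρ * (2 * N ^ 2) * (q * E) ≤ N ^ 2 * (q * (ρ * E - ρ * Dg + Dg * N ^ 2)) :=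
    hlow.trans (mul_le_mul_of_nonneg_left hup hN2.le)
  have h6 : 2 * ρ * E ≤ ρ * E - ρ * Dg + Dg * N ^ 2 := by
    have : (q * N ^ 2) * (2 * ρ * E) ≤ (q * N ^ 2) * (ρ * E - ρ * Dg + Dg * N ^ 2) := by
      linarith
    exact le_of_mul_le_mul_left this (by positivity)
  have h7 : N ^ 4 ≤ E * ρ := by
    have : (2 * N ^ 2) * N ^ 4 ≤ (2 * N ^ 2) * (E * ρ) := by
      linarith
    exact le_of_mul_le_mul_left this (by positivity)
  have h8 : Dg * N ^ 2 ≤ N ^ 4 := by nlinarith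
  nlinarith [mul_pos hρ0 hD]

/-- The gap / product lemma. -/
theorem gap (hψ : ψ ≠ 1) (hH : IsGrp H) {w z ξ : F} (hξ : ξ ≠ 0)
    (hw : S ψ H w ≠ 0) (hz : S ψ H z ≠ 0)
    (hE : 2 * (H.card : ℝ) ^ 6 ≤ (coll H ξ).card * (‖S ψ H w‖ ^ 2 * ‖S ψ H z‖ ^ 2)) :
    ∃ v : F, v ≠ 0 ∧ ‖S ψ H w‖ ^ 2 * ‖S ψ H z‖ ^ 2 / (2 * (H.card : ℝ) ^ 2) ≤
      ‖S ψ H (w * ξ * v)‖ * ‖S ψ H (z * v)‖ := by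
  by_contra! hcon
  set N : ℝ := (H.card : ℝ) with hNdef
  set ρ := ‖S ψ H w‖ ^ 2 * ‖S ψ H z‖ ^ 2 / (2 * N ^ 2) with hρ
  have hNpos : 0 < N := by
    have : 0 < H.card := Finset.card_pos.mpr ⟨1, hH.one_mem⟩
    rw [hNdef]; positivity
  have hq : (0 : ℝ) < Fintype.card F := by exact_mod_cast Fintype.card_pos
  have hρ0 : 0 < ρ := by
    have := norm_pos_iff.mpr hw
    have := norm_pos_iff.mpr hz
    positivity
  have hid := coll_identity ψ H hψ w z ξ
  set L : ℝ := ∑ t : F, (∑ k ∈ H, ‖S ψ H (t + k * w)‖ ^ 2) * (∑ k ∈ H, ‖S ψ H (ξ * t + k * z)‖ ^ 2)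
    with hL
  have hup : L ≤ Fintype.card F * ∑ x ∈ coll H ξ,
      ‖S ψ H (w * (x.1.1 - x.1.2))‖ * ‖S ψ H (z * (x.2.1 - x.2.2))‖ := by
    have : L ≤ ‖(L : ℂ)‖ := by rw [Complex.norm_real]; exact le_abs_self _
    refine this.trans ?_
    rw [hid, norm_mul, Complex.norm_natCast]
    gcongr
    refine (norm_sum_le _ _).trans (le_of_eq ?_)
    refine Finset.sum_congr rfl fun x _ => norm_mul _ _
  have hlow : (‖S ψ H w‖ ^ 2 * ‖S ψ H z‖ ^ 2) * (Fintype.card F * ((coll H ξ).card : ℝ))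
      ≤ N ^ 2 * L := by
    rw [← coll_card ψ H hψ hH ξ, hL, Finset.mul_sum, Finset.mul_sum]
    refine Finset.sum_le_sum fun t _ => ?_
    have h1 := smooth_lower ψ H hH w t
    have h2 := smooth_lower ψ H hH z (ξ * t)
    have := mul_le_mul h1 h2 (by positivity) (by positivity)
    refine le_trans (le_of_eq ?_) (this.trans (le_of_eq ?_)) <;> ring
  -- splitting
  have hterm : ∀ x ∈ coll H ξ, ‖S ψ H (w * (x.1.1 - x.1.2))‖ * ‖S ψ H (z * (x.2.1 - x.2.2))‖ ≤
      ρ - ρ * (if x.2.1 = x.2.2 then 1 else 0) + (if x.2.1 = x.2.2 then N ^ 2 else 0) ∧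
      (x.2.1 ≠ x.2.2 → ‖S ψ H (w * (x.1.1 - x.1.2))‖ * ‖S ψ H (z * (x.2.1 - x.2.2))‖ < ρ) := by
    intro x hx
    have hx2 := (Finset.mem_filter.mp hx).2
    by_cases hb : x.2.1 = x.2.2
    · refine ⟨?_, fun h => absurd hb h⟩
      simp only [hb, if_true, mul_one, sub_self, zero_add]
      rw [sq]
      exact mul_le_mul (norm_S_le ψ H _) (norm_S_le ψ H _) (norm_nonneg _) hNpos.le
    · have hv : x.2.2 - x.2.1 ≠ 0 := sub_ne_zero.mpr (Ne.symm hb)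
      have := hcon _ hv
      have e1 : w * (x.1.1 - x.1.2) = w * ξ * (x.2.2 - x.2.1) := by
        have : x.1.1 - x.1.2 = ξ * (x.2.2 - x.2.1) := by linear_combination hx2
        rw [this]; ring
      have e2 : z * (x.2.1 - x.2.2) = -(z * (x.2.2 - x.2.1)) := by ring
      rw [e1, e2, norm_S_neg]
      refine ⟨?_, fun _ => this⟩
      simp only [hb, if_false, mul_zero, sub_zero, add_zero]
      exact this.le
  -- diagonal count
  have hdiag : ((coll H ξ).filter fun x => x.2.1 = x.2.2).card ≤ H.card ^ 2 := by
    have : H.card ^ 2 = (H ×ˢ H).card := by rw [Finset.card_product, sq]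
    rw [this]
    refine Finset.card_le_card_of_injOn (fun x => (x.1.1, x.2.1)) ?_ ?_
    · intro x hx
      simp only [coll, Finset.coe_filter, Finset.mem_filter, Finset.mem_product,
        Set.mem_ofPred_eq] at hx
      simp [hx.1.1.1.1, hx.1.1.2.1]
    · rintro ⟨⟨a, a'⟩, b, b'⟩ hx ⟨⟨c, c'⟩, d, d'⟩ hy hxy
      simp only [coll, Finset.coe_filter, Finset.mem_filter, Finset.mem_product,
        Set.mem_ofPred_eq, Prod.mk.injEq] at hx hy hxy
      obtain ⟨⟨_, h1⟩, rfl⟩ := hx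
      obtain ⟨⟨_, h2⟩, rfl⟩ := hy
      obtain ⟨rfl, rfl⟩ := hxy
      simp only [sub_self, mul_zero, add_zero] at h1 h2
      rw [sub_eq_zero] at h1 h2
      subst h1; subst h2; rfl
  have hdiag0 : 0 < ((coll H ξ).filter fun x => x.2.1 = x.2.2).card := by
    refine Finset.card_pos.mpr ⟨((1, 1), (1, 1)), ?_⟩
    simp [coll, hH.one_mem]
  set Dg : ℝ := (((coll H ξ).filter fun x => x.2.1 = x.2.2).card : ℝ) with hDg
  have hDg1 : Dg ≤ N ^ 2 := by rw [hDg, hNdef]; exact_mod_cast hdiag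
  have hDg0 : 0 < Dg := by rw [hDg]; exact_mod_cast hdiag0
  have hsum : ∑ x ∈ coll H ξ, ‖S ψ H (w * (x.1.1 - x.1.2))‖ * ‖S ψ H (z * (x.2.1 - x.2.2))‖ ≤
      ρ * (coll H ξ).card - ρ * Dg + Dg * N ^ 2 := by
    refine (Finset.sum_le_sum fun x hx => (hterm x hx).1).trans (le_of_eq ?_)
    rw [Finset.sum_add_distrib, Finset.sum_sub_distrib, ← Finset.mul_sum, ← Finset.sum_filter,
      ← Finset.sum_filter]
    simp only [Finset.sum_const, nsmul_eq_mul, mul_one]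
    rw [hDg]; ring
  have h3 : (‖S ψ H w‖ ^ 2 * ‖S ψ H z‖ ^ 2) = ρ * (2 * N ^ 2) := by
    rw [hρ]; field_simp
  rw [h3] at hE hlow
  exact gap_arith hNpos hq hρ0 hDg0 hDg1 hlow (hup.trans (mul_le_mul_of_nonneg_left hsum hq.le)) hE

theorem coll_lower (hψ : ψ ≠ 1) (hH : IsGrp H) (ξ : F) {t : F} (ht : t ≠ 0) :
    H.card * (‖S ψ H t‖ * ‖S ψ H (ξ * t)‖) ^ 2 ≤ Fintype.card F * ((coll H ξ).card : ℝ) := by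
  rw [← coll_card ψ H hψ hH ξ]
  have h1 : ∑ x ∈ H.image (fun h => h * t), ‖S ψ H x‖ ^ 2 * ‖S ψ H (ξ * x)‖ ^ 2 =
      H.card * (‖S ψ H t‖ * ‖S ψ H (ξ * t)‖) ^ 2 := by
    rw [Finset.sum_image (fun a _ b _ hab => mul_right_cancel₀ ht hab)]
    rw [Finset.sum_congr rfl (g := fun _ => (‖S ψ H t‖ * ‖S ψ H (ξ * t)‖) ^ 2)]
    · simp
    · intro h hh
      have : ξ * (h * t) = h * (ξ * t) := by ring
      rw [this, S_dilate ψ H hH hh, S_dilate ψ H hH hh]; ring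
  rw [← h1]
  exact Finset.sum_le_univ_sum_of_nonneg (fun x => by positivity)


theorem coll_lower' (hH : IsGrp H) (ξ : F) {t : F} (ht : t ≠ 0) :
    H.card * (‖S ψ H t‖ * ‖S ψ H (ξ * t)‖) ^ 2 ≤
      ∑ t ∈ Finset.univ.erase (0 : F), ‖S ψ H t‖ ^ 2 * ‖S ψ H (ξ * t)‖ ^ 2 := by
  have h1 : ∑ x ∈ H.image (fun h => h * t), ‖S ψ H x‖ ^ 2 * ‖S ψ H (ξ * x)‖ ^ 2 =
      H.card * (‖S ψ H t‖ * ‖S ψ H (ξ * t)‖) ^ 2 := by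
    rw [Finset.sum_image (fun a _ b _ hab => mul_right_cancel₀ ht hab)]
    rw [Finset.sum_congr rfl (g := fun _ => (‖S ψ H t‖ * ‖S ψ H (ξ * t)‖) ^ 2)]
    · simp
    · intro h hh
      have : ξ * (h * t) = h * (ξ * t) := by ring
      rw [this, S_dilate ψ H hH hh, S_dilate ψ H hH hh]; ring
  rw [← h1]
  refine Finset.sum_le_sum_of_subset_of_nonneg ?_ (fun x _ _ => by positivity)
  intro x hx
  obtain ⟨h, hh, rfl⟩ := Finset.mem_image.mp hx
  exact Finset.mem_erase.mpr ⟨mul_ne_zero (hH.ne_zero hh) ht, Finset.mem_univ _⟩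

open Classical in
/-- The set of popular ratios. -/
noncomputable def R (ψ : AddChar F ℂ) (H : Finset F) : Finset F :=
  Finset.univ.filter fun ξ => ξ ≠ 0 ∧ ∃ t : F, t ≠ 0 ∧
    ‖S ψ H 1‖ ^ 4 / (2 * (H.card : ℝ) ^ 2) ≤ ‖S ψ H t‖ * ‖S ψ H (ξ * t)‖

theorem mem_R {ξ : F} : ξ ∈ R ψ H ↔ ξ ≠ 0 ∧ ∃ t : F, t ≠ 0 ∧
    ‖S ψ H 1‖ ^ 4 / (2 * (H.card : ℝ) ^ 2) ≤ ‖S ψ H t‖ * ‖S ψ H (ξ * t)‖ := by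
  simp [R]

theorem card_pos_of_grp (hH : IsGrp H) : (0 : ℝ) < H.card := by
  have : 0 < H.card := Finset.card_pos.mpr ⟨1, hH.one_mem⟩
  exact_mod_cast this

theorem q_pos : (0 : ℝ) < Fintype.card F := by exact_mod_cast Fintype.card_pos

theorem gapR (hψ : ψ ≠ 1) (hH : IsGrp H) (hs : S ψ H 1 ≠ 0) {ξ t : F} {B : ℝ} (hξ : ξ ≠ 0)
    (ht : t ≠ 0) (hB : 0 ≤ B) (hBt : B ≤ ‖S ψ H t‖ * ‖S ψ H (ξ * t)‖)
    (hc : 2 * (H.card : ℝ) ^ 5 * Fintype.card F ≤ B ^ 2 * ‖S ψ H 1‖ ^ 4) : ξ ∈ R ψ H := by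
  have hN := card_pos_of_grp H hH
  have hq : (0 : ℝ) < Fintype.card F := q_pos
  have h1 := coll_lower ψ H hψ hH ξ ht
  have h2 : H.card * B ^ 2 ≤ Fintype.card F * ((coll H ξ).card : ℝ) := by
    refine le_trans ?_ h1
    gcongr
  have h3 : 2 * (H.card : ℝ) ^ 6 ≤ (coll H ξ).card * (‖S ψ H 1‖ ^ 2 * ‖S ψ H 1‖ ^ 2) := by
    have hs4 : 0 ≤ ‖S ψ H 1‖ ^ 4 := by positivity
    have a := mul_le_mul_of_nonneg_right h2 hs4
    have b := mul_le_mul_of_nonneg_left hc hN.le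
    refine le_of_mul_le_mul_left ?_ hq
    linarith
  obtain ⟨v, hv, h4⟩ := gap ψ H hψ hH hξ hs hs h3
  rw [mem_R]
  refine ⟨hξ, v, hv, ?_⟩
  rw [one_mul, one_mul, mul_comm] at h4
  refine le_trans (le_of_eq ?_) (h4.trans (le_of_eq (mul_comm _ _)))
  ring

theorem half_le (hH : IsGrp H) :
    ‖S ψ H 1‖ ^ 4 / (2 * (H.card : ℝ) ^ 2) ≤ ‖S ψ H 1‖ * ‖S ψ H 1‖ := by
  have hN := card_pos_of_grp H hH
  have h := norm_S_le ψ H 1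
  have h0 := norm_nonneg (S ψ H 1)
  rw [div_le_iff₀ (by positivity)]
  have : ‖S ψ H 1‖ ^ 2 ≤ (H.card : ℝ) ^ 2 := by gcongr
  nlinarith [sq_nonneg (‖S ψ H 1‖)]

theorem H_sub_R (hH : IsGrp H) : H ⊆ R ψ H := by
  intro h hh
  rw [mem_R]
  refine ⟨hH.ne_zero hh, 1, one_ne_zero, ?_⟩
  rw [S_dilate ψ H hH hh]
  exact half_le ψ H hH

theorem neg_one_R (hH : IsGrp H) : (-1 : F) ∈ R ψ H := by
  rw [mem_R]
  refine ⟨by simp, 1, one_ne_zero, ?_⟩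
  rw [mul_one, norm_S_neg]
  exact half_le ψ H hH

theorem inv_R {ξ : F} (h : ξ ∈ R ψ H) : ξ⁻¹ ∈ R ψ H := by
  rw [mem_R] at *
  obtain ⟨h0, t, ht, h1⟩ := h
  refine ⟨inv_ne_zero h0, ξ * t, mul_ne_zero h0 ht, ?_⟩
  rw [inv_mul_cancel_left₀ h0, mul_comm (‖S ψ H (ξ * t)‖)]
  exact h1

theorem mul_R (hψ : ψ ≠ 1) (hH : IsGrp H) (hs : S ψ H 1 ≠ 0)
    (c1 : 32 * (H.card : ℝ) ^ 13 * Fintype.card F ≤ ‖S ψ H 1‖ ^ 16)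
    (c2 : 128 * (H.card : ℝ) ^ 17 * Fintype.card F ≤ ‖S ψ H 1‖ ^ 20)
    {ξ η : F} (h : ξ ∈ R ψ H) (h' : η ∈ R ψ H) : ξ * η ∈ R ψ H := by
  have hN := card_pos_of_grp H hH
  have hq : (0 : ℝ) < Fintype.card F := q_pos
  have hs0 := norm_pos_iff.mpr hs
  obtain ⟨hξ, t, ht, h1⟩ := (mem_R ψ H).mp h
  obtain ⟨hη, u, hu, h2⟩ := (mem_R ψ H).mp h'
  set s := ‖S ψ H 1‖ with hsdef
  set N : ℝ := (H.card : ℝ) with hNdef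
  set q : ℝ := (Fintype.card F : ℝ) with hqdef
  have hBpos : 0 < s ^ 4 / (2 * N ^ 2) := by positivity
  have hu0 : S ψ H u ≠ 0 := by
    intro h0
    rw [h0] at h2; simp at h2; linarith
  have hu1 : S ψ H (η * u) ≠ 0 := by
    intro h0
    rw [h0] at h2; simp at h2; linarith
  have h3 := coll_lower ψ H hψ hH ξ ht
  have h4 : N * (s ^ 4 / (2 * N ^ 2)) ^ 2 ≤ q * ((coll H ξ).card : ℝ) := by
    refine le_trans ?_ h3
    gcongr
  have h5 : (s ^ 4 / (2 * N ^ 2)) ^ 2 ≤ ‖S ψ H (η * u)‖ ^ 2 * ‖S ψ H u‖ ^ 2 := by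
    rw [← mul_pow, mul_comm (‖S ψ H (η * u)‖)]
    gcongr
  have h6 : 2 * N ^ 6 ≤ (coll H ξ).card * (‖S ψ H (η * u)‖ ^ 2 * ‖S ψ H u‖ ^ 2) := by
    have a : N * (s ^ 4 / (2 * N ^ 2)) ^ 2 * (s ^ 4 / (2 * N ^ 2)) ^ 2 ≤
      q * ((coll H ξ).card : ℝ) * (‖S ψ H (η * u)‖ ^ 2 * ‖S ψ H u‖ ^ 2) :=
      mul_le_mul h4 h5 (by positivity) (by positivity)
    have b : q * (2 * N ^ 6) ≤ N * (s ^ 4 / (2 * N ^ 2)) ^ 2 * (s ^ 4 / (2 * N ^ 2)) ^ 2 := by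
      have e : N * (s ^ 4 / (2 * N ^ 2)) ^ 2 * (s ^ 4 / (2 * N ^ 2)) ^ 2 =
        s ^ 16 / (16 * N ^ 7) := by field_simp; norm_num
      rw [e, le_div_iff₀ (by positivity)]
      linarith
    refine le_of_mul_le_mul_left ?_ hq
    linarith
  obtain ⟨v, hv, h7⟩ := gap ψ H hψ hH hξ hu1 hu0 h6
  refine gapR ψ H hψ hH hs (t := u * v) (B := (s ^ 4 / (2 * N ^ 2)) ^ 2 / (2 * N ^ 2))
    (mul_ne_zero hξ hη) (mul_ne_zero hu hv) (by positivity) ?_ ?_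
  · have : ξ * η * (u * v) = η * u * ξ * v := by ring
    rw [this, mul_comm (‖S ψ H (u * v)‖)]
    refine le_trans ?_ h7
    gcongr
  · have e : ((s ^ 4 / (2 * N ^ 2)) ^ 2 / (2 * N ^ 2)) ^ 2 * s ^ 4 = s ^ 20 / (64 * N ^ 12) := by
      field_simp; norm_num
    rw [e, le_div_iff₀ (by positivity)]
    linarith

theorem R_grp (hψ : ψ ≠ 1) (hH : IsGrp H) (hs : S ψ H 1 ≠ 0)
    (c1 : 32 * (H.card : ℝ) ^ 13 * Fintype.card F ≤ ‖S ψ H 1‖ ^ 16)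
    (c2 : 128 * (H.card : ℝ) ^ 17 * Fintype.card F ≤ ‖S ψ H 1‖ ^ 20) : IsGrp (R ψ H) where
  one_mem := H_sub_R ψ H hH hH.one_mem
  zero_notMem := by simp [mem_R]
  mul_mem := fun _ ha _ hb => mul_R ψ H hψ hH hs c1 c2 ha hb
  inv_mem := fun _ ha => inv_R ψ H ha

theorem R_card (hψ : ψ ≠ 1) (hH : IsGrp H) :
    ((R ψ H).card : ℝ) * ‖S ψ H 1‖ ^ 8 ≤ 4 * (Fintype.card F : ℝ) ^ 2 * (H.card : ℝ) ^ 5 := by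
  have hN := card_pos_of_grp H hH
  have hq : (0 : ℝ) < Fintype.card F := q_pos
  set s := ‖S ψ H 1‖ with hsdef
  have h1 : ((R ψ H).card : ℝ) * (H.card * (s ^ 4 / (2 * (H.card : ℝ) ^ 2)) ^ 2) ≤
      ∑ ξ ∈ R ψ H, ∑ t ∈ Finset.univ.erase (0 : F), ‖S ψ H t‖ ^ 2 * ‖S ψ H (ξ * t)‖ ^ 2 := by
    rw [← nsmul_eq_mul]
    refine Finset.card_nsmul_le_sum _ _ _ fun ξ hξ => ?_
    obtain ⟨_, t, ht, h⟩ := (mem_R ψ H).mp hξ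
    refine le_trans ?_ (coll_lower' ψ H hH ξ ht)
    gcongr
  have h2 : ∑ ξ ∈ R ψ H, ∑ t ∈ Finset.univ.erase (0 : F), ‖S ψ H t‖ ^ 2 * ‖S ψ H (ξ * t)‖ ^ 2 ≤
      (Fintype.card F * (H.card : ℝ)) ^ 2 := by
    rw [Finset.sum_comm, sq]
    nth_rewrite 1 [← parseval ψ H hψ]
    rw [Finset.sum_mul]
    refine le_trans (Finset.sum_le_sum fun t ht => ?_)
      (Finset.sum_le_univ_sum_of_nonneg fun t => by positivity)
    rw [← Finset.mul_sum]
    gcongr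
    have ht0 : t ≠ 0 := (Finset.mem_erase.mp ht).1
    rw [← parseval_mul ψ H hψ ht0]
    simp_rw [mul_comm _ t]
    exact Finset.sum_le_univ_sum_of_nonneg fun t => by positivity
  have h3 := h1.trans h2
  have e : ((R ψ H).card : ℝ) * (H.card * (s ^ 4 / (2 * (H.card : ℝ) ^ 2)) ^ 2) =
    ((R ψ H).card : ℝ) * s ^ 8 / (4 * (H.card : ℝ) ^ 3) := by field_simp; norm_num
  rw [e, div_le_iff₀ (by positivity)] at h3
  linarith

/-- solutions of `ξ h - η k = d`. -/
def sol (H : Finset F) (ξ η d : F) : Finset (F × F) :=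
  (H ×ˢ H).filter fun x => ξ * x.1 - η * x.2 = d

theorem sol_sum (hψ : ψ ≠ 1) (ξ η d : F) :
    ∑ t : F, S ψ H (ξ * t) * S ψ H (-(η * t)) * ψ (-(d * t)) =
      Fintype.card F * ((sol H ξ η d).card : ℂ) := by
  have h0 : ∀ t : F, S ψ H (ξ * t) * S ψ H (-(η * t)) * ψ (-(d * t)) =
      ∑ x ∈ H ×ˢ H, ψ (t * (ξ * x.1 - η * x.2 - d)) := by
    intro t
    unfold S
    rw [Finset.sum_mul_sum, Finset.sum_product, Finset.sum_mul]
    refine Finset.sum_congr rfl fun a _ => ?_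
    rw [Finset.sum_mul]
    refine Finset.sum_congr rfl fun b _ => ?_
    rw [← AddChar.map_add_eq_mul, ← AddChar.map_add_eq_mul]
    congr 1; ring
  rw [Finset.sum_congr rfl fun t _ => h0 t, Finset.sum_comm]
  simp_rw [orth ψ hψ, sub_eq_zero]
  rw [← Finset.sum_filter]
  simp [sol, mul_comm]

theorem sol_sum' (hψ : ψ ≠ 1) (hH : IsGrp H) (ξ η d : F) :
    ∑ t : F, S ψ H (ξ * t) * S ψ H (-(η * t)) * S ψ H (-(d * t)) =
      H.card * (Fintype.card F * ((sol H ξ η d).card : ℂ)) := by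
  have h1 : ∀ l ∈ H, ∑ t : F, S ψ H (ξ * t) * S ψ H (-(η * t)) * ψ (-(d * t) * l) =
      Fintype.card F * ((sol H ξ η d).card : ℂ) := by
    intro l hl
    rw [← sol_sum ψ H hψ ξ η d]
    refine Fintype.sum_equiv (Equiv.mulLeft₀ l (hH.ne_zero hl)) _ _ fun t => ?_
    have e1 : ξ * (l * t) = l * (ξ * t) := by ring
    have e2 : -(η * (l * t)) = l * (-(η * t)) := by ring
    have e3 : -(d * (l * t)) = -(d * t) * l := by ring
    change _ = S ψ H (ξ * (l * t)) * S ψ H (-(η * (l * t))) * ψ (-(d * (l * t)))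
    rw [e1, e2, e3, S_dilate ψ H hH hl, S_dilate ψ H hH hl]
  have h2 : ∀ t : F, S ψ H (ξ * t) * S ψ H (-(η * t)) * S ψ H (-(d * t)) =
      ∑ l ∈ H, S ψ H (ξ * t) * S ψ H (-(η * t)) * ψ (-(d * t) * l) := by
    intro t
    rw [← Finset.mul_sum]; rfl
  rw [Finset.sum_congr rfl fun t _ => h2 t, Finset.sum_comm, Finset.sum_congr rfl h1]
  simp

theorem xyz_bound {x y z m : ℝ} (hx : 0 ≤ x) (hy : 0 ≤ y) (hz : 0 ≤ z) (hm : 0 ≤ m)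
    (h : x * z ≤ m ^ 2 / 64) :
    x * y * z ≤ m / 16 * (x ^ 2 + y ^ 2 + y ^ 2 + z ^ 2) := by
  have h1 : x * y * z ≤ m / 8 * (x * y + y * z) := by
    rcases le_total x (m / 8) with h2 | h2
    · have := mul_le_mul_of_nonneg_right h2 (mul_nonneg hy hz)
      have := mul_nonneg (mul_nonneg hx hy) hm
      nlinarith
    · rcases le_total z (m / 8) with h3 | h3
      · have := mul_le_mul_of_nonneg_right h3 (mul_nonneg hx hy)
        have := mul_nonneg (mul_nonneg hy hz) hm
        nlinarith
      · have h4 : x * z = m / 8 * (m / 8) :=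
          le_antisymm (by nlinarith) (mul_le_mul h2 h3 (by positivity) hx)
        have := mul_le_mul_of_nonneg_left h2 (mul_nonneg hy (div_nonneg hm (by norm_num : (0:ℝ) ≤ 8)))
        have h5 : x * y * z = y * (m / 8) * (m / 8) := by linear_combination y * h4
        have := mul_nonneg (mul_nonneg hy hz) hm
        nlinarith
  have h2 : m / 8 * (x * y + y * z) ≤ m / 8 * ((x ^ 2 + y ^ 2 + y ^ 2 + z ^ 2) / 2) := by
    refine mul_le_mul_of_nonneg_left ?_ (by positivity)
    nlinarith [sq_nonneg (x - y), sq_nonneg (y - z)]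
  linarith

theorem three_term (hψ : ψ ≠ 1) (hH : IsGrp H) {ξ η d : F} (hξ : ξ ≠ 0) (hη : η ≠ 0) (hd : d ≠ 0)
    (hm : 2 * (H.card : ℝ) ^ 2 ≤ Fintype.card F * ((sol H ξ η d).card : ℝ)) :
    ∃ t : F, t ≠ 0 ∧ ((sol H ξ η d).card : ℝ) ^ 2 / 64 ≤ ‖S ψ H (ξ * t)‖ * ‖S ψ H (d * t)‖ := by
  by_contra! hcon
  have hN := card_pos_of_grp H hH
  have hq : (0 : ℝ) < Fintype.card F := q_pos
  set m : ℝ := ((sol H ξ η d).card : ℝ) with hmdef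
  have hm0 : 0 ≤ m := by positivity
  have h1 : H.card * (Fintype.card F * m) ≤
      ∑ t : F, ‖S ψ H (ξ * t)‖ * ‖S ψ H (η * t)‖ * ‖S ψ H (d * t)‖ := by
    have h := congrArg norm (sol_sum' ψ H hψ hH ξ η d)
    rw [norm_mul, norm_mul, Complex.norm_natCast, Complex.norm_natCast, Complex.norm_natCast] at h
    rw [hmdef, ← h]
    refine (norm_sum_le _ _).trans (le_of_eq ?_)
    refine Finset.sum_congr rfl fun t _ => ?_
    rw [norm_mul, norm_mul, norm_S_neg, norm_S_neg]
  have h2 : ∑ t ∈ Finset.univ.erase (0 : F),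
      ‖S ψ H (ξ * t)‖ * ‖S ψ H (η * t)‖ * ‖S ψ H (d * t)‖ ≤
      m / 16 * (4 * (Fintype.card F * (H.card : ℝ))) := by
    have h3 : ∑ t : F, m / 16 * (‖S ψ H (ξ * t)‖ ^ 2 + ‖S ψ H (η * t)‖ ^ 2 + ‖S ψ H (η * t)‖ ^ 2
        + ‖S ψ H (d * t)‖ ^ 2) = m / 16 * (4 * (Fintype.card F * (H.card : ℝ))) := by
      rw [← Finset.mul_sum, Finset.sum_add_distrib, Finset.sum_add_distrib, Finset.sum_add_distrib,
        parseval_mul ψ H hψ hξ, parseval_mul ψ H hψ hη, parseval_mul ψ H hψ hd]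
      ring
    rw [← h3]
    refine le_trans (Finset.sum_le_sum fun t ht => ?_)
      (Finset.sum_le_univ_sum_of_nonneg fun t => by positivity)
    exact xyz_bound (norm_nonneg _) (norm_nonneg _) (norm_nonneg _) hm0
      (hcon t (Finset.mem_erase.mp ht).1).le
  rw [← Finset.add_sum_erase _ _ (Finset.mem_univ (0 : F))] at h1
  simp only [mul_zero, S_zero, Complex.norm_natCast] at h1
  have h4 : H.card * (2 * (H.card : ℝ) ^ 2) ≤ H.card * (Fintype.card F * m) :=
    mul_le_mul_of_nonneg_left hm hN.le
  have h5 : 0 < H.card * (2 * (H.card : ℝ) ^ 2) := by positivity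
  nlinarith

theorem avg_sol (hH : IsGrp H) (Q : Finset F) (hQ : IsGrp Q) (hHQ : H ⊆ Q) (d : F) {T : ℝ}
    (hT : T ≤ ((Q.filter fun x => x - d ∈ Q).card : ℝ)) :
    ∃ ξ ∈ Q, ∃ η ∈ Q, (H.card : ℝ) ^ 2 * T ≤ (Q.card : ℝ) ^ 2 * ((sol H ξ η d).card : ℝ) := by
  by_contra! hcon
  have h1 : ∀ y ∈ H ×ˢ H, (Q.filter fun x => x - d ∈ Q).card ≤
      ((Q ×ˢ Q).filter fun x => x.1 * y.1 - x.2 * y.2 = d).card := by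
    rintro ⟨h, k⟩ hy
    obtain ⟨hh, hk⟩ := Finset.mem_product.mp hy
    simp only at hh hk
    have hh0 := hH.ne_zero hh
    have hk0 := hH.ne_zero hk
    refine Finset.card_le_card_of_injOn (fun x => (x * h⁻¹, (x - d) * k⁻¹)) ?_ ?_
    · intro x hx
      simp only [Finset.coe_filter, Set.mem_ofPred_eq] at hx
      simp only [Finset.coe_filter, Set.mem_ofPred_eq, Finset.mem_product]
      refine ⟨⟨hQ.mul_mem _ hx.1 _ (hHQ (hH.inv_mem _ hh)),
        hQ.mul_mem _ hx.2 _ (hHQ (hH.inv_mem _ hk))⟩, ?_⟩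
      field_simp; ring
    · intro x _ y _ hxy
      simp only [Prod.mk.injEq] at hxy
      exact mul_right_cancel₀ (inv_ne_zero hh0) hxy.1
  have h2 : ∑ y ∈ H ×ˢ H, ((Q ×ˢ Q).filter fun x => x.1 * y.1 - x.2 * y.2 = d).card =
      ∑ x ∈ Q ×ˢ Q, (sol H x.1 x.2 d).card := by
    simp only [sol, Finset.card_filter]
    rw [Finset.sum_comm]
  have h3 : (H.card : ℝ) ^ 2 * T ≤ ∑ x ∈ Q ×ˢ Q, ((sol H x.1 x.2 d).card : ℝ) := by
    have a := Finset.card_nsmul_le_sum _ _ _ h1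
    rw [h2, Finset.card_product, smul_eq_mul, ← sq] at a
    have b : (H.card : ℝ) ^ 2 * ((Q.filter fun x => x - d ∈ Q).card : ℝ) ≤
      ∑ x ∈ Q ×ˢ Q, ((sol H x.1 x.2 d).card : ℝ) := by exact_mod_cast a
    refine le_trans ?_ b
    gcongr
  have hQp := card_pos_of_grp Q hQ
  have h4 : ∑ x ∈ Q ×ˢ Q, (Q.card : ℝ) ^ 2 * ((sol H x.1 x.2 d).card : ℝ) <
      ∑ x ∈ Q ×ˢ Q, (H.card : ℝ) ^ 2 * T := by
    refine Finset.sum_lt_sum_of_nonempty ⟨(1, 1), by simp [hQ.one_mem]⟩ fun x hx => ?_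
    obtain ⟨a, b⟩ := Finset.mem_product.mp hx
    exact hcon _ a _ b
  rw [← Finset.mul_sum, Finset.sum_const, Finset.card_product, nsmul_eq_mul] at h4
  push_cast at h4
  have : (Q.card : ℝ) ^ 2 * ((H.card : ℝ) ^ 2 * T) ≤
    (Q.card : ℝ) ^ 2 * ∑ x ∈ Q ×ˢ Q, ((sol H x.1 x.2 d).card : ℝ) :=
    mul_le_mul_of_nonneg_left h3 (by positivity)
  nlinarith

theorem popular_diff (hψ : ψ ≠ 1) (hH : IsGrp H) (hs : S ψ H 1 ≠ 0) (hR : IsGrp (R ψ H))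
    {d : F} (hd : d ≠ 0) {T : ℝ} (hT0 : 0 ≤ T)
    (hT : T ≤ (((R ψ H).filter fun x => x - d ∈ R ψ H).card : ℝ))
    (c1 : 2 * ((R ψ H).card : ℝ) ^ 2 ≤ Fintype.card F * T)
    (c2 : 8192 * (H.card : ℝ) ^ 5 * Fintype.card F ≤
      ((H.card : ℝ) ^ 2 * T / ((R ψ H).card : ℝ) ^ 2) ^ 4 * ‖S ψ H 1‖ ^ 4) : d ∈ R ψ H := by
  have hN := card_pos_of_grp H hH
  have hq : (0 : ℝ) < Fintype.card F := q_pos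
  have hRp := card_pos_of_grp _ hR
  obtain ⟨ξ, hξ, η, hη, h1⟩ := avg_sol H hH _ hR (H_sub_R ψ H hH) d hT
  have hξ0 := hR.ne_zero hξ
  have h2 : (H.card : ℝ) ^ 2 * T / ((R ψ H).card : ℝ) ^ 2 ≤ ((sol H ξ η d).card : ℝ) := by
    rw [div_le_iff₀ (by positivity)]; linarith
  have h3 : 2 * (H.card : ℝ) ^ 2 ≤ Fintype.card F * ((sol H ξ η d).card : ℝ) := by
    have a : Fintype.card F * ((H.card : ℝ) ^ 2 * T / ((R ψ H).card : ℝ) ^ 2) ≤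
      Fintype.card F * ((sol H ξ η d).card : ℝ) := mul_le_mul_of_nonneg_left h2 hq.le
    refine le_trans ?_ a
    rw [mul_div_assoc', le_div_iff₀ (by positivity)]
    have := mul_le_mul_of_nonneg_left c1 (sq_nonneg (H.card : ℝ))
    linarith
  obtain ⟨t, ht, h4⟩ := three_term ψ H hψ hH hξ0 (hR.ne_zero hη) hd h3
  have h5 : d / ξ ∈ R ψ H := by
    refine gapR ψ H hψ hH hs (t := ξ * t) (B := ((sol H ξ η d).card : ℝ) ^ 2 / 64)
      (div_ne_zero hd hξ0) (mul_ne_zero hξ0 ht) (by positivity) ?_ ?_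
    · have : d / ξ * (ξ * t) = d * t := by field_simp
      rw [this]; exact h4
    · have a : ((H.card : ℝ) ^ 2 * T / ((R ψ H).card : ℝ) ^ 2) ^ 4 * ‖S ψ H 1‖ ^ 4 ≤
        ((sol H ξ η d).card : ℝ) ^ 4 * ‖S ψ H 1‖ ^ 4 := by gcongr
      have e : (((sol H ξ η d).card : ℝ) ^ 2 / 64) ^ 2 * ‖S ψ H 1‖ ^ 4 =
        ((sol H ξ η d).card : ℝ) ^ 4 * ‖S ψ H 1‖ ^ 4 / 4096 := by ring
      rw [e]
      linarith
  have : d = d / ξ * ξ := by field_simp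
  rw [this]
  exact hR.mul_mem _ h5 _ hξ

theorem A1_card (hH : IsGrp H) :
    ‖S ψ H 1‖ ^ 2 ≤ 2 * (H.card : ℝ) *
      ((H.filter fun h => 1 - h ∈ R ψ H ∨ 1 - h = 0).card : ℝ) := by
  have hN := card_pos_of_grp H hH
  set A := H.filter fun h => 1 - h ∈ R ψ H ∨ 1 - h = 0 with hA
  set s := ‖S ψ H 1‖ with hsdef
  have hs0 : 0 ≤ s := norm_nonneg _
  have hsN : s ≤ H.card := norm_S_le ψ H 1
  have h1 : s ^ 2 ≤ ∑ h ∈ H, ‖S ψ H (1 - h)‖ := by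
    have h := congrArg norm (spherical ψ H hH 1 (-1))
    rw [norm_mul, norm_S_neg] at h
    rw [sq, ← h]
    refine (norm_sum_le _ _).trans (le_of_eq ?_)
    refine Finset.sum_congr rfl fun k _ => ?_
    congr 2; ring
  have h2 : ∀ h ∈ H, ‖S ψ H (1 - h)‖ ≤ (if h ∈ A then (H.card : ℝ) else 0) +
      s ^ 2 / (2 * H.card) := by
    intro h hh
    by_cases hhA : h ∈ A
    · rw [if_pos hhA]
      have := norm_S_le ψ H (1 - h)
      have : 0 ≤ s ^ 2 / (2 * (H.card : ℝ)) := by positivity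
      linarith
    · rw [if_neg hhA, zero_add]
      by_contra! hlt
      apply hhA
      rw [hA, Finset.mem_filter]
      refine ⟨hh, ?_⟩
      by_cases h0 : 1 - h = 0
      · exact Or.inr h0
      · left
        rw [mem_R]
        refine ⟨h0, 1, one_ne_zero, ?_⟩
        rw [mul_one]
        have a : s * (s ^ 2 / (2 * H.card)) ≤ s * ‖S ψ H (1 - h)‖ :=
          mul_le_mul_of_nonneg_left hlt.le hs0
        refine le_trans ?_ a
        rw [mul_div_assoc', div_le_div_iff₀ (by positivity) (by positivity)]
        have : 0 ≤ s ^ 3 * (2 * (H.card : ℝ)) := by positivity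
        nlinarith [mul_le_mul_of_nonneg_left hsN this]
  have h3 := h1.trans (Finset.sum_le_sum h2)
  rw [Finset.sum_add_distrib, Finset.sum_const, nsmul_eq_mul] at h3
  have h4 : ∑ h ∈ H, (if h ∈ A then (H.card : ℝ) else 0) = A.card * (H.card : ℝ) := by
    rw [← Finset.sum_filter, Finset.filter_mem_eq_inter,
      Finset.inter_eq_right.mpr (Finset.filter_subset _ _), Finset.sum_const, nsmul_eq_mul]
  rw [h4] at h3
  have h5 : (H.card : ℝ) * (s ^ 2 / (2 * H.card)) = s ^ 2 / 2 := by field_simp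
  rw [h5] at h3
  linarith

theorem exists_preimage (X : Finset F) (f : F → F) (hf : Function.Injective f)
    (hX : ∀ x ∈ X, f x ∈ X) {x : F} (hx : x ∈ X) : ∃ y ∈ X, f y = x := by
  have h : X.image f = X := by
    apply Finset.eq_of_subset_of_card_le
    · intro y hy
      obtain ⟨z, hz, rfl⟩ := Finset.mem_image.mp hy
      exact hX z hz
    · rw [Finset.card_image_of_injective _ hf]
  rw [← h] at hx
  obtain ⟨y, hy, rfl⟩ := Finset.mem_image.mp hx
  exact ⟨y, hy, rfl⟩

/-- The subfield of multipliers of a finite additive subgroup. -/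
def multSubfield (U : Finset F) (h0 : (0 : F) ∈ U) (hadd : ∀ a ∈ U, ∀ b ∈ U, a + b ∈ U)
    (hneg : ∀ a ∈ U, -a ∈ U) : Subfield F where
  carrier := {x | ∀ u ∈ U, x * u ∈ U}
  mul_mem' := by
    intro a b ha hb u hu
    rw [mul_assoc]; exact ha _ (hb _ hu)
  one_mem' := by intro u hu; rwa [one_mul]
  add_mem' := by
    intro a b ha hb u hu
    rw [add_mul]; exact hadd _ (ha _ hu) _ (hb _ hu)
  zero_mem' := by intro u _; rwa [zero_mul]
  neg_mem' := by
    intro a ha u hu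
    rw [neg_mul]; exact hneg _ (ha _ hu)
  inv_mem' := by
    intro a ha u hu
    by_cases ha0 : a = 0
    · rw [ha0, inv_zero, zero_mul]; exact h0
    · obtain ⟨y, hy, rfl⟩ := exists_preimage U (fun x => a * x) (mul_right_injective₀ ha0) ha hu
      simp only [inv_mul_cancel_left₀ ha0]; exact hy

theorem mem_multSubfield (U : Finset F) (h0 hadd hneg) {x : F} :
    x ∈ multSubfield U h0 hadd hneg ↔ ∀ u ∈ U, x * u ∈ U := Iff.rfl

section Clique

variable (H Q : Finset F)

/-- the relation: `x - y ∈ Q ∪ {0}` -/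
def Adj (Q : Finset F) (x y : F) : Prop := x - y ∈ insert 0 Q

instance (Q : Finset F) (x y : F) : Decidable (Adj Q x y) := by unfold Adj; infer_instance

theorem adj_refl (x : F) : Adj Q x x := by simp [Adj]

theorem adj_symm (hQ : IsGrp Q) (hneg : (-1 : F) ∈ Q) {x y : F} (h : Adj Q x y) : Adj Q y x := by
  unfold Adj at *
  rw [Finset.mem_insert] at *
  rcases h with h | h
  · left; rw [← neg_sub, h, neg_zero]
  · right
    have := hQ.mul_mem _ hneg _ h
    have e : y - x = -1 * (x - y) := by ring
    rw [e]; exact this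

theorem adj_dilate (hQ : IsGrp Q) {x y k : F} (hk : k ∈ Q) (h : Adj Q x y) :
    Adj Q (k * x) (k * y) := by
  unfold Adj at *
  rw [← mul_sub]
  rw [Finset.mem_insert] at *
  rcases h with h | h
  · left; rw [h, mul_zero]
  · right; exact hQ.mul_mem _ hk _ h

theorem adj_dilate_iff (hQ : IsGrp Q) {x y k : F} (hk : k ∈ Q) :
    Adj Q (k * x) (k * y) ↔ Adj Q x y := by
  refine ⟨fun h => ?_, adj_dilate Q hQ hk⟩
  have := adj_dilate Q hQ (hQ.inv_mem _ hk) h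
  rwa [inv_mul_cancel_left₀ (hQ.ne_zero hk), inv_mul_cancel_left₀ (hQ.ne_zero hk)] at this

theorem adj_add_iff {x y d : F} : Adj Q (x + d) (y + d) ↔ Adj Q x y := by
  unfold Adj; rw [add_sub_add_right_eq_sub]

variable {H Q}

theorem bad_pairs (hH : IsGrp H) (hQ : IsGrp Q) (hHQ : H ⊆ Q) (hneg : (-1 : F) ∈ Q) {K : ℕ}
    (hb : ∀ (v w : F) (Z : Finset F), K ≤ Z.card → (∀ a ∈ Z, Adj Q v a ∧ Adj Q w a) → Adj Q v w)
    {A : Finset F} (hA : A = H.filter fun h => Adj Q 1 h) :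
    ((A ×ˢ A).filter fun x => ¬ Adj Q x.1 x.2).card ≤ H.card * K := by
  set P := ((A ×ˢ A).filter fun x => ¬ Adj Q x.1 x.2).card with hP
  have hmemA : ∀ x, x ∈ A ↔ x ∈ H ∧ Adj Q 1 x := by intro x; rw [hA, Finset.mem_filter]
  have h1 : ∀ c ∈ H, P ≤ ((H ×ˢ H).filter fun x =>
      (Adj Q x.1 c ∧ Adj Q x.2 c) ∧ ¬ Adj Q x.1 x.2).card := by
    intro c hc
    have hc0 := hH.ne_zero hc
    refine Finset.card_le_card_of_injOn (fun x => (c * x.1, c * x.2)) ?_ ?_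
    · rintro ⟨a, b⟩ hx
      simp only [Finset.coe_filter, Set.mem_ofPred_eq, Finset.mem_product, hmemA] at hx
      obtain ⟨⟨⟨a1, a2⟩, b1, b2⟩, hab⟩ := hx
      simp only [Finset.coe_filter, Set.mem_ofPred_eq, Finset.mem_product]
      refine ⟨⟨hH.mul_mem _ hc _ a1, hH.mul_mem _ hc _ b1⟩, ⟨?_, ?_⟩, ?_⟩
      · have := adj_dilate Q hQ (hHQ hc) (adj_symm Q hQ hneg a2)
        rwa [mul_one] at this
      · have := adj_dilate Q hQ (hHQ hc) (adj_symm Q hQ hneg b2)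
        rwa [mul_one] at this
      · rwa [adj_dilate_iff Q hQ (hHQ hc)]
    · rintro ⟨a, b⟩ _ ⟨a', b'⟩ _ hxy
      simp only [Prod.mk.injEq] at hxy
      rw [mul_right_injective₀ hc0 hxy.1, mul_right_injective₀ hc0 hxy.2]
  have h2 : ∑ c ∈ H, ((H ×ˢ H).filter fun x =>
      (Adj Q x.1 c ∧ Adj Q x.2 c) ∧ ¬ Adj Q x.1 x.2).card =
      ∑ x ∈ H ×ˢ H, (H.filter fun c => (Adj Q x.1 c ∧ Adj Q x.2 c) ∧ ¬ Adj Q x.1 x.2).card := by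
    simp only [Finset.card_filter]
    rw [Finset.sum_comm]
  have h3 : ∀ x ∈ H ×ˢ H,
      (H.filter fun c => (Adj Q x.1 c ∧ Adj Q x.2 c) ∧ ¬ Adj Q x.1 x.2).card ≤ K := by
    intro x _
    by_contra! hlt
    obtain ⟨c, hc⟩ := Finset.card_pos.mp (lt_of_le_of_lt (Nat.zero_le K) hlt)
    have hn := (Finset.mem_filter.mp hc).2.2
    exact hn (hb _ _ _ hlt.le fun a ha => (Finset.mem_filter.mp ha).2.1)
  have h4 := Finset.card_nsmul_le_sum _ _ _ h1
  rw [h2] at h4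
  have h5 := h4.trans (Finset.sum_le_card_nsmul _ _ _ h3)
  rw [Finset.card_product, smul_eq_mul, smul_eq_mul, mul_assoc] at h5
  exact Nat.le_of_mul_le_mul_left h5 (Finset.card_pos.mpr ⟨1, hH.one_mem⟩)

theorem exists_clique (hH : IsGrp H) (hQ : IsGrp Q) (hHQ : H ⊆ Q) (hneg : (-1 : F) ∈ Q) {K : ℕ}
    (hb : ∀ (v w : F) (Z : Finset F), K ≤ Z.card → (∀ a ∈ Z, Adj Q v a ∧ Adj Q w a) → Adj Q v w)
    {A : Finset F} (hA : A = H.filter fun h => Adj Q 1 h)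
    (hbig : 8 * (Q.card * K) < A.card ^ 2) :
    ∃ A' ⊆ A, A.card ≤ 2 * A'.card ∧ ∀ a ∈ A', ∀ b ∈ A', Adj Q a b := by
  have hHQc : H.card ≤ Q.card := Finset.card_le_card hHQ
  have hAH : A.card ≤ H.card := by rw [hA]; exact Finset.card_filter_le _ _
  have hP := bad_pairs hH hQ hHQ hneg hb hA
  have hHK : H.card * K ≤ Q.card * K := Nat.mul_le_mul_right _ hHQc
  have hK : 8 * K ≤ A.card := by
    by_contra! h
    have h1 : A.card ^ 2 ≤ Q.card * A.card := by
      rw [sq]; exact Nat.mul_le_mul_right _ (hAH.trans hHQc)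
    have h2 : Q.card * A.card ≤ Q.card * (8 * K) := Nat.mul_le_mul_left _ h.le
    nlinarith
  refine ⟨A.filter fun a => 4 * (A.filter fun b => ¬ Adj Q a b).card ≤ A.card,
    Finset.filter_subset _ _, ?_, ?_⟩
  · set A' := A.filter fun a => 4 * (A.filter fun b => ¬ Adj Q a b).card ≤ A.card with hA'
    set A'' := A.filter fun a => ¬ (4 * (A.filter fun b => ¬ Adj Q a b).card ≤ A.card) with hA''
    have hsum : A'.card + A''.card = A.card := Finset.card_filter_add_card_filter_not _
    have h1 : ((A ×ˢ A).filter fun x => ¬ Adj Q x.1 x.2).card =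
        ∑ a ∈ A, (A.filter fun b => ¬ Adj Q a b).card := by
      simp only [Finset.card_filter]
      rw [Finset.sum_product]
    have h2 : A''.card * A.card ≤ ∑ a ∈ A'', 4 * (A.filter fun b => ¬ Adj Q a b).card := by
      rw [← smul_eq_mul]
      refine Finset.card_nsmul_le_sum _ _ _ fun a ha => ?_
      have := (Finset.mem_filter.mp ha).2
      omega
    have h3 : ∑ a ∈ A'', 4 * (A.filter fun b => ¬ Adj Q a b).card ≤
        ∑ a ∈ A, 4 * (A.filter fun b => ¬ Adj Q a b).card :=
      Finset.sum_le_sum_of_subset (Finset.filter_subset _ _)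
    rw [← Finset.mul_sum A, ← h1] at h3
    by_contra! hlt
    have h4 : A.card < 2 * A''.card := by omega
    have h5 : A.card * A.card ≤ 2 * A''.card * A.card := Nat.mul_le_mul_right _ h4.le
    nlinarith
  · intro a ha b hb'
    obtain ⟨ha1, ha2⟩ := Finset.mem_filter.mp ha
    obtain ⟨hb1, hb2⟩ := Finset.mem_filter.mp hb'
    refine hb a b (A.filter fun c => Adj Q a c ∧ Adj Q b c) ?_
      fun c hc => (Finset.mem_filter.mp hc).2
    have h1 : (A.filter fun c => Adj Q a c ∧ Adj Q b c).card +
        (A.filter fun c => ¬ (Adj Q a c ∧ Adj Q b c)).card = A.card :=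
      Finset.card_filter_add_card_filter_not _
    have h2 : (A.filter fun c => ¬ (Adj Q a c ∧ Adj Q b c)).card ≤
        (A.filter fun c => ¬ Adj Q a c).card + (A.filter fun c => ¬ Adj Q b c).card := by
      refine le_trans (Finset.card_le_card ?_) (Finset.card_union_le _ _)
      intro c hc
      simp only [Finset.mem_union, Finset.mem_filter] at *
      tauto
    omega

theorem core (hH : IsGrp H) (hQ : IsGrp Q) (hHQ : H ⊆ Q) (hneg : (-1 : F) ∈ Q) {K : ℕ}
    (hK0 : 0 < K)
    (hb : ∀ (v w : F) (Z : Finset F), K ≤ Z.card → (∀ a ∈ Z, Adj Q v a ∧ Adj Q w a) → Adj Q v w)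
    {A : Finset F} (hA : A = H.filter fun h => Adj Q 1 h)
    (hbig : 8 * (Q.card * K) < A.card ^ 2) (hq : Q.card + 1 < Fintype.card F) :
    ∃ (G : Subfield F) (H0 : Finset F), G ≠ ⊤ ∧ H0 ⊆ H ∧ (∀ h ∈ H0, h ∈ G) ∧
      A.card ≤ 4 * H0.card := by
  classical
  obtain ⟨A', hA'A, hA'c, hcl⟩ := exists_clique hH hQ hHQ hneg hb hA hbig
  have hHQc : H.card ≤ Q.card := Finset.card_le_card hHQ
  have hAH : A ⊆ H := by rw [hA]; exact Finset.filter_subset _ _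
  have hAHc : A.card ≤ H.card := Finset.card_le_card hAH
  have hHK : H.card * K ≤ Q.card * K := Nat.mul_le_mul_right _ hHQc
  have hK : 8 * K ≤ A.card := by
    by_contra! h
    have h1 : A.card ^ 2 ≤ Q.card * A.card := by
      rw [sq]; exact Nat.mul_le_mul_right _ (hAHc.trans hHQc)
    have h2 : Q.card * A.card ≤ Q.card * (8 * K) := Nat.mul_le_mul_left _ h.le
    nlinarith
  have hQpos : 0 < Q.card := Finset.card_pos.mpr ⟨1, hQ.one_mem⟩
  set W : Finset F := Finset.univ.filter fun x => ∀ a ∈ A', Adj Q x a with hW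
  have hWmem : ∀ x, x ∈ W ↔ ∀ a ∈ A', Adj Q x a := by intro x; simp [hW]
  have hA'W : A' ⊆ W := fun a ha => (hWmem a).mpr (hcl a ha)
  have hA'K : K ≤ A'.card := by omega
  have hWcl : ∀ x ∈ W, ∀ y ∈ W, Adj Q x y := by
    intro x hx y hy
    exact hb x y A' hA'K fun a ha => ⟨(hWmem x).mp hx a ha, (hWmem y).mp hy a ha⟩
  have hmax : ∀ (x : F) (Z : Finset F), Z ⊆ W → K ≤ Z.card → (∀ z ∈ Z, Adj Q x z) → x ∈ W := by
    intro x Z hZW hZ hx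
    rw [hWmem]
    intro a ha
    exact hb x a Z hZ fun z hz => ⟨hx z hz, hWcl a (hA'W ha) z (hZW hz)⟩
  have hWA' : A'.card ≤ W.card := Finset.card_le_card hA'W
  -- multiplicative stabiliser
  set V : Finset F := W ∩ H with hV
  have hA'V : A' ⊆ V := Finset.subset_inter hA'W (hA'A.trans hAH)
  have hVc : A'.card ≤ V.card := Finset.card_le_card hA'V
  set H0 : Finset F := H.filter fun h => ∀ w ∈ W, h * w ∈ W with hH0
  have hdil : ∀ h ∈ H, K ≤ (W.filter fun y => h * y ∈ W).card → h ∈ H0 := by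
    intro h hh hc
    rw [hH0, Finset.mem_filter]
    refine ⟨hh, fun w hw => ?_⟩
    refine hmax _ ((W.filter fun y => h * y ∈ W).image fun y => h * y) ?_ ?_ ?_
    · intro z hz
      obtain ⟨y, hy, rfl⟩ := Finset.mem_image.mp hz
      exact (Finset.mem_filter.mp hy).2
    · rw [Finset.card_image_of_injective _ (mul_right_injective₀ (hH.ne_zero hh))]; exact hc
    · intro z hz
      obtain ⟨y, hy, rfl⟩ := Finset.mem_image.mp hz
      exact adj_dilate Q hQ (hHQ hh) (hWcl w hw y (Finset.mem_filter.mp hy).1)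
  have hVsq : V.card ^ 2 ≤ H0.card * V.card + H.card * K := by
    have h1 : V.card ^ 2 = ∑ h ∈ H, (V.filter fun y => h * y ∈ V).card := by
      have e1 : ∀ y ∈ V, (H.filter fun h => h * y ∈ V).card = V.card := by
        intro y hy
        have hyH : y ∈ H := (Finset.mem_inter.mp hy).2
        have hy0 := hH.ne_zero hyH
        apply Finset.card_bij (fun h _ => h * y)
        · intro h hh; exact (Finset.mem_filter.mp hh).2
        · intro h _ h' _ e; exact mul_right_cancel₀ hy0 e
        · intro v hv
          refine ⟨v * y⁻¹, ?_, by field_simp⟩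
          rw [Finset.mem_filter]
          refine ⟨hH.mul_mem _ (Finset.mem_inter.mp hv).2 _ (hH.inv_mem _ hyH), ?_⟩
          rwa [inv_mul_cancel_right₀ hy0]
      have e2 : ∑ h ∈ H, (V.filter fun y => h * y ∈ V).card =
          ∑ y ∈ V, (H.filter fun h => h * y ∈ V).card := by
        simp only [Finset.card_filter]
        rw [Finset.sum_comm]
      rw [e2, Finset.sum_congr rfl e1, Finset.sum_const, smul_eq_mul, sq]
    have h2 : ∀ h ∈ H, (V.filter fun y => h * y ∈ V).card ≤ (if h ∈ H0 then V.card else 0) + K := by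
      intro h hh
      by_cases hh0 : h ∈ H0
      · rw [if_pos hh0]
        exact (Finset.card_filter_le _ _).trans (Nat.le_add_right _ _)
      · rw [if_neg hh0, zero_add]
        by_contra! hlt
        apply hh0
        apply hdil h hh
        refine hlt.le.trans (Finset.card_le_card ?_)
        intro y hy
        rw [Finset.mem_filter] at *
        exact ⟨(Finset.mem_inter.mp hy.1).1, (Finset.mem_inter.mp hy.2).1⟩
    rw [h1]
    refine (Finset.sum_le_sum h2).trans (le_of_eq ?_)
    rw [Finset.sum_add_distrib, ← Finset.sum_filter, Finset.filter_mem_eq_inter,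
      Finset.inter_eq_right.mpr (Finset.filter_subset _ _), Finset.sum_const, Finset.sum_const,
      smul_eq_mul, smul_eq_mul]
  have hH0c : A.card ≤ 4 * H0.card := by
    by_contra! hlt
    have h1 : A.card ^ 2 ≤ (2 * V.card) ^ 2 := Nat.pow_le_pow_left (by omega) 2
    have h2 : 2 * H0.card < V.card := by omega
    have h3 : 2 * H0.card * V.card ≤ V.card * V.card := Nat.mul_le_mul_right _ h2.le
    nlinarith
  -- additive stabiliser
  set U : Finset F := Finset.univ.filter fun d => ∀ w ∈ W, w + d ∈ W with hU
  have hUmem : ∀ d, d ∈ U ↔ ∀ w ∈ W, w + d ∈ W := by intro d; simp [hU]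
  have hU0 : (0 : F) ∈ U := by rw [hUmem]; intro w hw; rwa [add_zero]
  have hUadd : ∀ a ∈ U, ∀ b ∈ U, a + b ∈ U := by
    intro a ha b hb'
    rw [hUmem] at *
    intro w hw
    rw [← add_assoc]; exact hb' _ (ha _ hw)
  have hUneg : ∀ a ∈ U, -a ∈ U := by
    intro a ha
    rw [hUmem] at *
    intro w hw
    obtain ⟨y, hy, rfl⟩ := exists_preimage W (fun w => w + a) (add_left_injective a) ha hw
    simpa using hy
  have htr : ∀ d, K ≤ (W.filter fun y => y + d ∈ W).card → d ∈ U := by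
    intro d hc
    rw [hUmem]
    intro w hw
    refine hmax _ ((W.filter fun y => y + d ∈ W).image fun y => y + d) ?_ ?_ ?_
    · intro z hz
      obtain ⟨y, hy, rfl⟩ := Finset.mem_image.mp hz
      exact (Finset.mem_filter.mp hy).2
    · rw [Finset.card_image_of_injective _ (add_left_injective d)]; exact hc
    · intro z hz
      obtain ⟨y, hy, rfl⟩ := Finset.mem_image.mp hz
      exact (adj_add_iff Q).mpr (hWcl w hw y (Finset.mem_filter.mp hy).1)
  have hUne : ∃ u ∈ U, u ≠ 0 := by
    by_contra! hcon
    have h1 : W.card ^ 2 = ∑ d ∈ insert 0 Q, (W.filter fun y => y + d ∈ W).card := by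
      have e1 : ∀ y ∈ W, ((insert 0 Q).filter fun d => y + d ∈ W).card = W.card := by
        intro y hy
        apply Finset.card_bij (fun d _ => y + d)
        · intro h hh; exact (Finset.mem_filter.mp hh).2
        · intro h _ h' _ e; exact add_left_cancel e
        · intro v hv
          refine ⟨v - y, ?_, by ring⟩
          rw [Finset.mem_filter]
          refine ⟨hWcl v hv y hy, ?_⟩
          rwa [add_sub_cancel]
      have e2 : ∑ d ∈ insert 0 Q, (W.filter fun y => y + d ∈ W).card =
          ∑ y ∈ W, ((insert 0 Q).filter fun d => y + d ∈ W).card := by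
        simp only [Finset.card_filter]
        rw [Finset.sum_comm]
      rw [e2, Finset.sum_congr rfl e1, Finset.sum_const, smul_eq_mul, sq]
    rw [Finset.sum_insert hQ.zero_notMem] at h1
    have h2 : ∑ d ∈ Q, (W.filter fun y => y + d ∈ W).card ≤ Q.card * K := by
      rw [← smul_eq_mul]
      refine Finset.sum_le_card_nsmul _ _ _ fun d hd => ?_
      by_contra! hlt
      exact hQ.ne_zero hd (hcon d (htr d hlt.le))
    have h3 : (W.filter fun y => y + 0 ∈ W).card ≤ W.card := Finset.card_filter_le _ _
    have h4 : A.card ^ 2 ≤ (2 * W.card) ^ 2 := Nat.pow_le_pow_left (by omega) 2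
    have h5 : 1 ≤ Q.card * K := Nat.mul_pos hQpos hK0
    have h6 : 2 ≤ W.card := by
      by_contra! hlt
      have : W.card ^ 2 ≤ 1 ^ 2 := Nat.pow_le_pow_left (by omega) 2
      nlinarith
    have h7 : 2 * W.card ≤ W.card * W.card := Nat.mul_le_mul_right _ h6
    nlinarith
  have hH0U : ∀ h ∈ H0, ∀ u ∈ U, h * u ∈ U := by
    intro h hh u hu
    obtain ⟨hhH, hhW⟩ := Finset.mem_filter.mp hh
    rw [hUmem] at *
    intro w hw
    obtain ⟨y, hy, rfl⟩ := exists_preimage W (fun w => h * w)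
      (mul_right_injective₀ (hH.ne_zero hhH)) hhW hw
    have := hhW _ (hu y hy)
    rw [mul_add] at this
    exact this
  have hUQ : U ⊆ insert 0 Q := by
    intro d hd
    obtain ⟨w, hw⟩ : W.Nonempty := Finset.card_pos.mp (by omega)
    have := hWcl _ ((hUmem d).mp hd w hw) w hw
    unfold Adj at this
    rwa [add_sub_cancel_left] at this
  refine ⟨multSubfield U hU0 hUadd hUneg, H0, ?_, Finset.filter_subset _ _,
    fun h hh => (mem_multSubfield U hU0 hUadd hUneg).mpr (hH0U h hh), hH0c⟩
  intro htop
  obtain ⟨u, hu, hu0⟩ := hUne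
  have h1 : (Finset.univ : Finset F) ⊆ U := by
    intro y _
    have hy : y / u ∈ multSubfield U hU0 hUadd hUneg := by rw [htop]; exact Subfield.mem_top _
    have := (mem_multSubfield U hU0 hUadd hUneg).mp hy u hu
    rwa [div_mul_cancel₀ _ hu0] at this
  have h2 := (Finset.card_le_card (h1.trans hUQ)).trans (Finset.card_insert_le _ _)
  rw [Finset.card_univ] at h2
  omega

end Clique

theorem main_core (hψ : ψ ≠ 1) (hH : IsGrp H) (hs : S ψ H 1 ≠ 0)
    (c1 : 32 * (H.card : ℝ) ^ 13 * Fintype.card F ≤ ‖S ψ H 1‖ ^ 16)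
    (c2 : 128 * (H.card : ℝ) ^ 17 * Fintype.card F ≤ ‖S ψ H 1‖ ^ 20)
    (c3 : 768 * (H.card : ℝ) ^ 7 * (Fintype.card F : ℝ) ^ 2 ≤ ‖S ψ H 1‖ ^ 12)
    (c4 : 8192 * (H.card : ℝ) ^ 17 * (Fintype.card F : ℝ) ^ 5 ≤ ‖S ψ H 1‖ ^ 28)
    (c5 : 2 ^ 61 * (H.card : ℝ) ^ 65 * (Fintype.card F : ℝ) ^ 25 ≤ ‖S ψ H 1‖ ^ 116)
    (c6 : 16 * (H.card : ℝ) ^ 5 * (Fintype.card F : ℝ) ≤ ‖S ψ H 1‖ ^ 8) :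
    ∃ (G : Subfield F) (H0 : Finset F), G ≠ ⊤ ∧ H0 ⊆ H ∧ (∀ h ∈ H0, h ∈ G) ∧
      ‖S ψ H 1‖ ^ 2 ≤ 8 * (H.card : ℝ) * (H0.card : ℝ) := by
  have hR := R_grp ψ H hψ hH hs c1 c2
  have hRc := R_card ψ H hψ hH
  have hA1 := A1_card ψ H hH
  have hN := card_pos_of_grp H hH
  have hr := card_pos_of_grp _ hR
  have hq : (0 : ℝ) < Fintype.card F := q_pos
  have hq2 : (2 : ℝ) ≤ Fintype.card F := by
    have := Fintype.one_lt_card (α := F)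
    exact_mod_cast this
  have hs0 := norm_pos_iff.mpr hs
  have hAeq : (H.filter fun h => 1 - h ∈ R ψ H ∨ 1 - h = 0) =
      H.filter fun h => Adj (R ψ H) 1 h := by
    apply Finset.filter_congr
    intro h _
    unfold Adj
    rw [Finset.mem_insert, or_comm]
  rw [hAeq] at hA1
  have hpop : ∀ (d : F) (T : ℝ), d ≠ 0 → 0 ≤ T →
    T ≤ (((R ψ H).filter fun x => x - d ∈ R ψ H).card : ℝ) →
    2 * ((R ψ H).card : ℝ) ^ 2 ≤ Fintype.card F * T →
    8192 * (H.card : ℝ) ^ 5 * Fintype.card F ≤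
      ((H.card : ℝ) ^ 2 * T / ((R ψ H).card : ℝ) ^ 2) ^ 4 * ‖S ψ H 1‖ ^ 4 → d ∈ R ψ H :=
    fun d T h1 h2 h3 h4 h5 => popular_diff ψ H hψ hH hs hR h1 h2 h3 h4 h5
  set s : ℝ := ‖S ψ H 1‖ with hsdef
  set N : ℝ := (H.card : ℝ) with hNdef
  set q : ℝ := (Fintype.card F : ℝ) with hqdef
  set r : ℝ := ((R ψ H).card : ℝ) with hrdef
  set A := H.filter fun h => Adj (R ψ H) 1 h with hA
  set T : ℝ := s ^ 4 / (64 * N ^ 2 * r) with hT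
  have hT0 : 0 < T := by positivity
  -- inequalities
  have i1 : 2 * r ^ 2 ≤ q * T := by
    have h3 : (r * s ^ 8) ^ 3 ≤ (4 * q ^ 2 * N ^ 5) ^ 3 := by gcongr
    have h4 : s ^ 24 * (128 * r ^ 3 * N ^ 2) ≤ s ^ 24 * (q * s ^ 4) := by
      calc s ^ 24 * (128 * r ^ 3 * N ^ 2) = 128 * N ^ 2 * (r * s ^ 8) ^ 3 := by ring
        _ ≤ 128 * N ^ 2 * (4 * q ^ 2 * N ^ 5) ^ 3 := by gcongr
        _ = q * (8192 * N ^ 17 * q ^ 5) := by ring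
        _ ≤ q * s ^ 28 := by gcongr
        _ = s ^ 24 * (q * s ^ 4) := by ring
    have h5 := le_of_mul_le_mul_left h4 (by positivity)
    rw [hT, mul_div_assoc', le_div_iff₀ (by positivity)]
    linarith
  have i2 : 8192 * N ^ 5 * q ≤ (N ^ 2 * T / r ^ 2) ^ 4 * s ^ 4 := by
    have e : (N ^ 2 * T / r ^ 2) ^ 4 * s ^ 4 = s ^ 20 / (2 ^ 24 * r ^ 12) := by
      rw [hT]; field_simp; norm_num
    rw [e, le_div_iff₀ (by positivity)]
    have h3 : (r * s ^ 8) ^ 12 ≤ (4 * q ^ 2 * N ^ 5) ^ 12 := by gcongr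
    have h4 : s ^ 96 * (8192 * N ^ 5 * q * (2 ^ 24 * r ^ 12)) ≤ s ^ 96 * s ^ 20 := by
      calc s ^ 96 * (8192 * N ^ 5 * q * (2 ^ 24 * r ^ 12))
          = 2 ^ 37 * N ^ 5 * q * (r * s ^ 8) ^ 12 := by ring
        _ ≤ 2 ^ 37 * N ^ 5 * q * (4 * q ^ 2 * N ^ 5) ^ 12 := by gcongr
        _ = 2 ^ 61 * N ^ 65 * q ^ 25 := by ring
        _ ≤ s ^ 116 := c5
        _ = s ^ 96 * s ^ 20 := by ring
    exact le_of_mul_le_mul_left h4 (by positivity)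
  have i3 : 192 * r * N ^ 2 ≤ s ^ 4 := by
    have h4 : s ^ 8 * (192 * r * N ^ 2) ≤ s ^ 8 * s ^ 4 := by
      calc s ^ 8 * (192 * r * N ^ 2) = 192 * N ^ 2 * (r * s ^ 8) := by ring
        _ ≤ 192 * N ^ 2 * (4 * q ^ 2 * N ^ 5) := by gcongr
        _ = 768 * N ^ 7 * q ^ 2 := by ring
        _ ≤ s ^ 12 := c3
        _ = s ^ 8 * s ^ 4 := by ring
    exact le_of_mul_le_mul_left h4 (by positivity)
  have i4 : r ≤ q / 4 := by
    have h4 : s ^ 8 * r ≤ s ^ 8 * (q / 4) := by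
      calc s ^ 8 * r = r * s ^ 8 := by ring
        _ ≤ 4 * q ^ 2 * N ^ 5 := hRc
        _ = q / 4 * (16 * N ^ 5 * q) := by ring
        _ ≤ q / 4 * s ^ 8 := by gcongr
        _ = s ^ 8 * (q / 4) := by ring
    exact le_of_mul_le_mul_left h4 (by positivity)
  have hq' : (R ψ H).card + 1 < Fintype.card F := by
    have : r + 1 < q := by linarith
    rw [hrdef, hqdef] at this
    exact_mod_cast this
  -- the threshold
  set K : ℕ := ⌈T⌉₊ + 2 with hK
  have hKT : T ≤ (K : ℝ) - 2 := by
    rw [hK]; push_cast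
    have := Nat.le_ceil T
    linarith
  have hKT' : (K : ℝ) < T + 3 := by
    rw [hK]; push_cast
    have := Nat.ceil_lt_add_one hT0.le
    linarith
  have hbig : 8 * ((R ψ H).card * K) < A.card ^ 2 := by
    have h1 : s ^ 4 / (4 * N ^ 2) ≤ (A.card : ℝ) ^ 2 := by
      rw [div_le_iff₀ (by positivity)]
      have : (s ^ 2) ^ 2 ≤ (2 * N * (A.card : ℝ)) ^ 2 := by gcongr
      nlinarith
    have h2 : 8 * (r * K) < 8 * (r * (T + 3)) := by gcongr
    have h3 : 8 * (r * (T + 3)) ≤ s ^ 4 / (4 * N ^ 2) := by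
      have e : 8 * (r * (T + 3)) = s ^ 4 / (8 * N ^ 2) + 24 * r := by
        rw [hT]; field_simp; ring
      have e2 : s ^ 4 / (4 * N ^ 2) = s ^ 4 / (8 * N ^ 2) + s ^ 4 / (8 * N ^ 2) := by
        field_simp; norm_num
      have : 24 * r ≤ s ^ 4 / (8 * N ^ 2) := by
        rw [le_div_iff₀ (by positivity)]; linarith
      linarith
    have h4 : 8 * (r * K) < (A.card : ℝ) ^ 2 := by linarith
    rw [hrdef] at h4
    exact_mod_cast h4
  have hb : ∀ (v w : F) (Z : Finset F), K ≤ Z.card →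
      (∀ a ∈ Z, Adj (R ψ H) v a ∧ Adj (R ψ H) w a) → Adj (R ψ H) v w := by
    intro v w Z hZ hvw
    by_cases hvw0 : v = w
    · rw [hvw0]; exact adj_refl _ _
    · unfold Adj
      rw [Finset.mem_insert]
      right
      refine hpop (v - w) T (sub_ne_zero.mpr hvw0) hT0.le ?_ i1 i2
      have h1 : ((Z.erase v).erase w).card ≤
          ((R ψ H).filter fun x => x - (v - w) ∈ R ψ H).card := by
        refine Finset.card_le_card_of_injOn (fun a => v - a) ?_ ?_
        · intro a ha
          have ha := Finset.mem_coe.mp ha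
          rw [Finset.mem_erase, Finset.mem_erase] at ha
          obtain ⟨haw, hav, haZ⟩ := ha
          obtain ⟨h1, h2⟩ := hvw a haZ
          unfold Adj at h1 h2
          rw [Finset.mem_insert] at h1 h2
          have h1' := h1.resolve_left (sub_ne_zero.mpr (Ne.symm hav))
          have h2' := h2.resolve_left (sub_ne_zero.mpr (Ne.symm haw))
          apply Finset.mem_coe.mpr
          rw [Finset.mem_filter]
          refine ⟨h1', ?_⟩
          have e : v - a - (v - w) = w - a := by ring
          rw [e]; exact h2'
        · intro a _ b _ hab
          exact sub_right_injective hab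
      have h2 : Z.card ≤ ((Z.erase v).erase w).card + 2 := by
        have a1 := Finset.pred_card_le_card_erase (s := Z) (a := v)
        have a2 := Finset.pred_card_le_card_erase (s := Z.erase v) (a := w)
        omega
      have h3 : K ≤ ((R ψ H).filter fun x => x - (v - w) ∈ R ψ H).card + 2 := by omega
      have h4 : (K : ℝ) ≤ (((R ψ H).filter fun x => x - (v - w) ∈ R ψ H).card : ℝ) + 2 := by
        exact_mod_cast h3
      linarith
  obtain ⟨G, H0, hG, hH0, hH0G, hc⟩ := core hH hR (H_sub_R ψ H hH) (neg_one_R ψ H hH)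
    (by omega : 0 < K) hb hA hbig hq'
  refine ⟨G, H0, hG, hH0, hH0G, ?_⟩
  have hc' : (A.card : ℝ) ≤ 4 * (H0.card : ℝ) := by exact_mod_cast hc
  have := mul_le_mul_of_nonneg_left hc' (by positivity : 0 ≤ 2 * N)
  linarith

/-- all power conditions follow from one. -/
theorem power_cond {s N q D : ℝ} (hs : 0 < s) (hN : 0 < N) (hq : 0 < q) (hD : 0 ≤ D) (hsN : s ≤ N)
    (hsq : s ^ 2 ≤ q) (h : D * q ^ 28 * N ^ 167 ≤ s ^ 224) (b b' e e' : ℕ) (hb : b + b' = 28)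
    (he : e + e' = 167) : D * N ^ e * q ^ b ≤ s ^ (2 * b + 1 + e) := by
  have h1 : s ^ 224 ≤ s ^ (2 * b + 1 + e) * (q ^ b' * N ^ e') := by
    have e1 : s ^ 224 = s ^ (2 * b + 1 + e) * ((s ^ 2) ^ b' * s ^ e') := by
      rw [← pow_mul, ← pow_add, ← pow_add]; congr 1; omega
    rw [e1]
    gcongr
  have h2 : D * q ^ 28 * N ^ 167 = (D * N ^ e * q ^ b) * (q ^ b' * N ^ e') := by
    rw [← hb, ← he, pow_add, pow_add]; ring
  rw [h2] at h
  exact le_of_mul_le_mul_right (h.trans h1) (by positivity)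

theorem s_sq_le (hψ : ψ ≠ 1) (hH : IsGrp H) : ‖S ψ H 1‖ ^ 2 ≤ (Fintype.card F : ℝ) := by
  have hN := card_pos_of_grp H hH
  have h1 : ∑ x ∈ H, ‖S ψ H x‖ ^ 2 ≤ ∑ x : F, ‖S ψ H x‖ ^ 2 :=
    Finset.sum_le_univ_sum_of_nonneg fun t => by positivity
  rw [parseval ψ H hψ] at h1
  have h2 : ∀ x ∈ H, ‖S ψ H x‖ ^ 2 = ‖S ψ H 1‖ ^ 2 := by
    intro x hx
    have := S_dilate ψ H hH hx 1
    rw [mul_one] at this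
    rw [this]
  rw [Finset.sum_congr rfl h2, Finset.sum_const, nsmul_eq_mul, mul_comm] at h1
  exact le_of_mul_le_mul_right h1 hN

theorem core_of_large (hψ : ψ ≠ 1) (hH : IsGrp H) (hs : S ψ H 1 ≠ 0) {D : ℝ} (hD : 2 ^ 61 ≤ D)
    (h : D * (Fintype.card F : ℝ) ^ 28 * (H.card : ℝ) ^ 167 ≤ ‖S ψ H 1‖ ^ 224) :
    ∃ (G : Subfield F) (H0 : Finset F), G ≠ ⊤ ∧ H0 ⊆ H ∧ (∀ h ∈ H0, h ∈ G) ∧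
      ‖S ψ H 1‖ ^ 2 ≤ 8 * (H.card : ℝ) * (H0.card : ℝ) := by
  have hN := card_pos_of_grp H hH
  have hq : (0 : ℝ) < Fintype.card F := q_pos
  have hs0 := norm_pos_iff.mpr hs
  have hsq := s_sq_le ψ H hψ hH
  have hsN := norm_S_le ψ H 1
  have hD0 : 0 ≤ D := le_trans (by positivity) hD
  have key := power_cond hs0 hN hq hD0 hsN hsq h
  have aux : ∀ (c : ℝ) (e b : ℕ), c ≤ 2 ^ 61 →
      c * (H.card : ℝ) ^ e * (Fintype.card F : ℝ) ^ b ≤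
      D * (H.card : ℝ) ^ e * (Fintype.card F : ℝ) ^ b := by
    intro c e b hc
    have := hc.trans hD
    gcongr
  refine main_core ψ H hψ hH hs ?_ ?_ ?_ ?_ ?_ ?_
  · have := (aux 32 13 1 (by norm_num)).trans (key 1 27 13 154 rfl rfl)
    rwa [pow_one] at this
  · have := (aux 128 17 1 (by norm_num)).trans (key 1 27 17 150 rfl rfl)
    rwa [pow_one] at this
  · exact (aux 768 7 2 (by norm_num)).trans (key 2 26 7 160 rfl rfl)
  · exact (aux 8192 17 5 (by norm_num)).trans (key 5 23 17 150 rfl rfl)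
  · exact (aux (2 ^ 61) 65 25 le_rfl).trans (key 25 3 65 102 rfl rfl)
  · have := (aux 16 5 1 (by norm_num)).trans (key 1 27 5 162 rfl rfl)
    rwa [pow_one] at this

/-- The group of nonzero `n`-th powers. -/
def powers (F : Type) [Field F] [Fintype F] [DecidableEq F] (n : ℕ) : Finset F :=
  Finset.univ.image fun u : Fˣ => ((u ^ n : Fˣ) : F)

theorem mem_powers {n : ℕ} {x : F} : x ∈ powers F n ↔ ∃ u : Fˣ, ((u ^ n : Fˣ) : F) = x := by
  simp [powers]

theorem powers_grp (n : ℕ) : IsGrp (powers F n) where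
  one_mem := mem_powers.mpr ⟨1, by simp⟩
  zero_notMem := by
    rw [mem_powers]
    rintro ⟨u, hu⟩
    exact Units.ne_zero _ hu
  mul_mem := by
    intro a ha b hb
    obtain ⟨u, rfl⟩ := mem_powers.mp ha
    obtain ⟨v, rfl⟩ := mem_powers.mp hb
    exact mem_powers.mpr ⟨u * v, by rw [mul_pow, Units.val_mul]⟩
  inv_mem := by
    intro a ha
    obtain ⟨u, rfl⟩ := mem_powers.mp ha
    exact mem_powers.mpr ⟨u⁻¹, by rw [inv_pow, Units.val_inv_eq_inv_val]⟩

theorem card_fiber {n : ℕ} (hn : n ∣ Fintype.card F - 1) (u₀ : Fˣ) :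
    (Finset.univ.filter fun u : Fˣ => ((u ^ n : Fˣ) : F) = ((u₀ ^ n : Fˣ) : F)).card = n := by
  have h1 : Nat.card (powMonoidHom n : Fˣ →* Fˣ).ker = n := by
    rw [IsCyclic.card_powMonoidHom_ker, Nat.card_eq_fintype_card, Fintype.card_units]
    exact Nat.gcd_eq_right hn
  have h2 : (Finset.univ.filter fun u : Fˣ => u ^ n = 1).card = n := by
    refine Eq.trans ?_ h1
    rw [Nat.card_eq_fintype_card, Fintype.card_subtype]
    congr 1
    ext u
    simp [MonoidHom.mem_ker]
  refine Eq.trans ?_ h2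
  apply Finset.card_bij (fun u _ => u * u₀⁻¹)
  · intro u hu
    have hu' := Units.ext (Finset.mem_filter.mp hu).2
    rw [Finset.mem_filter]
    refine ⟨Finset.mem_univ _, ?_⟩
    rw [mul_pow, hu', ← mul_pow, mul_inv_cancel, one_pow]
  · intro u _ v _ h
    exact mul_right_cancel h
  · intro v hv
    have hv' := (Finset.mem_filter.mp hv).2
    refine ⟨v * u₀, ?_, by group⟩
    rw [Finset.mem_filter]
    refine ⟨Finset.mem_univ _, ?_⟩
    rw [mul_pow, hv', one_mul]

theorem sum_powers {n : ℕ} (hn : n ∣ Fintype.card F - 1) {M : Type*} [AddCommMonoid M]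
    (g : F → M) : ∑ u : Fˣ, g ((u ^ n : Fˣ) : F) = n • ∑ h ∈ powers F n, g h := by
  have hmap : ∀ u ∈ (Finset.univ : Finset Fˣ), ((u ^ n : Fˣ) : F) ∈ powers F n :=
    fun u _ => mem_powers.mpr ⟨u, rfl⟩
  rw [← Finset.sum_fiberwise_of_maps_to hmap, ← Finset.sum_nsmul]
  refine Finset.sum_congr rfl fun h hh => ?_
  obtain ⟨u₀, rfl⟩ := mem_powers.mp hh
  rw [Finset.sum_congr rfl (g := fun _ => g ((u₀ ^ n : Fˣ) : F))]
  · rw [Finset.sum_const, card_fiber hn]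
  · intro u hu
    rw [(Finset.mem_filter.mp hu).2]

theorem card_powers {n : ℕ} (hn : n ∣ Fintype.card F - 1) :
    n * (powers F n).card = Fintype.card F - 1 := by
  have h := sum_powers hn (fun _ : F => (1 : ℕ))
  simp only [Finset.sum_const, smul_eq_mul, mul_one, Finset.card_univ, Fintype.card_units] at h
  exact h.symm

theorem n_pos {n : ℕ} (hn : n ∣ Fintype.card F - 1) : 0 < n := by
  have := Fintype.one_lt_card (α := F)
  exact Nat.pos_of_dvd_of_pos hn (by omega)

theorem gauss_eq {n : ℕ} (hn : n ∣ Fintype.card F - 1) :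
    ∑ x : F, ψ (x ^ n) = 1 + n * S ψ (powers F n) 1 := by
  have hn0 := n_pos hn
  rw [← Finset.add_sum_erase _ _ (Finset.mem_univ (0 : F)), zero_pow hn0.ne', AddChar.map_zero_eq_one]
  congr 1
  have h1 : ∑ x ∈ Finset.univ.erase (0 : F), ψ (x ^ n) = ∑ u : Fˣ, ψ ((u ^ n : Fˣ) : F) := by
    symm
    apply Finset.sum_bij (fun (u : Fˣ) _ => (u : F))
    · intro u _; exact Finset.mem_erase.mpr ⟨u.ne_zero, Finset.mem_univ _⟩
    · intro u _ v _ h; exact Units.ext h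
    · intro x hx
      exact ⟨Units.mk0 x (Finset.mem_erase.mp hx).1, Finset.mem_univ _, rfl⟩
    · intro u _; rw [Units.val_pow_eq_pow_val]
  rw [h1, sum_powers hn (fun x => ψ x), nsmul_eq_mul]
  simp [S]

theorem card_le_gcd {n : ℕ} (hn : n ∣ Fintype.card F - 1) (G : Subfield F) (H0 : Finset F)
    (h1 : H0 ⊆ powers F n) (h2 : ∀ h ∈ H0, h ∈ G) :
    H0.card ≤ Nat.gcd (powers F n).card (Nat.card G - 1) := by
  classical
  have hN : 0 < (powers F n).card := Finset.card_pos.mpr ⟨1, (powers_grp n).one_mem⟩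
  set d := Nat.gcd (powers F n).card (Nat.card G - 1) with hd
  have hd0 : 0 < d := Nat.gcd_pos_of_pos_left _ hN
  have key : ∀ x ∈ H0, x ^ d = 1 := by
    intro x hx
    obtain ⟨u, hu⟩ := mem_powers.mp (h1 hx)
    have hx0 : x ≠ 0 := by rw [← hu]; exact Units.ne_zero _
    have e1 : x ^ (powers F n).card = 1 := by
      rw [← hu, ← Units.val_pow_eq_pow_val, ← pow_mul, card_powers hn, Units.val_pow_eq_pow_val]
      exact FiniteField.pow_card_sub_one_eq_one _ u.ne_zero
    have e2 : x ^ (Nat.card G - 1) = 1 := by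
      have : Fintype G := Fintype.ofFinite G
      have h := FiniteField.pow_card_sub_one_eq_one (⟨x, h2 x hx⟩ : G)
        (by intro h; exact hx0 (congrArg Subtype.val h))
      rw [Nat.card_eq_fintype_card]
      have := congrArg Subtype.val h
      simpa using this
    rw [hd]
    exact pow_gcd_eq_one.mpr ⟨e1, e2⟩
  have h3 : H0 ⊆ (Polynomial.nthRoots d (1 : F)).toFinset := by
    intro x hx
    rw [Multiset.mem_toFinset, Polynomial.mem_nthRoots hd0]
    exact key x hx
  exact (Finset.card_le_card h3).trans
    ((Multiset.toFinset_card_le _).trans (Polynomial.card_nthRoots d 1))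

theorem gcd_identity {n N k P : ℕ} (hN : 0 < N) (h : n * N = k * P) :
    Nat.gcd n k * P = n * Nat.gcd N P := by
  have h1 : Nat.gcd n k * (N * P) = n * N * Nat.gcd N P := by
    rw [← Nat.gcd_mul_right, ← Nat.gcd_mul_left]
    rw [Nat.gcd_comm]
    congr 1
    · rw [h]; ring
    · ring
  apply Nat.eq_of_mul_eq_mul_left hN
  linarith

theorem subfield_card {p m : ℕ} (hp : p.Prime) (hF : Fintype.card F = p ^ m) (G : Subfield F)
    (hG : G ≠ ⊤) : ∃ ν, Nat.card G = p ^ ν ∧ ν ∣ m ∧ ν ≠ m := by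
  classical
  have : Fintype G := Fintype.ofFinite G
  have h1 : Fintype.card F = Fintype.card G ^ Module.finrank G F := Module.card_eq_pow_finrank
  have hr : Module.finrank G F ≠ 0 := by
    intro h
    rw [h, pow_zero] at h1
    exact absurd h1 (Fintype.one_lt_card (α := F)).ne'
  have h2 : Fintype.card G ∣ p ^ m := by
    rw [← hF, h1]; exact dvd_pow_self _ hr
  obtain ⟨ν, _, hν⟩ := (Nat.dvd_prime_pow hp).mp h2
  refine ⟨ν, by rw [Nat.card_eq_fintype_card, hν], ?_, ?_⟩
  · rw [hF, hν, ← pow_mul] at h1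
    exact ⟨_, Nat.pow_right_injective hp.two_le h1⟩
  · rintro rfl
    apply hG
    rw [eq_top_iff]
    intro x _
    have hb : Function.Bijective (Subtype.val : G → F) := by
      rw [Fintype.bijective_iff_injective_and_card]
      exact ⟨Subtype.val_injective, by rw [hν, hF]⟩
    obtain ⟨y, rfl⟩ := hb.2 x
    exact y.2

theorem H0_bound {c₁ : ℝ} (hc : 0 < c₁) {p m n : ℕ} (hp : p.Prime) (hF : Fintype.card F = p ^ m)
    (hn : n ∣ Fintype.card F - 1)
    (hgcd : ∀ ν : ℕ, ν ∣ m → ν ≠ m →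
          (Nat.gcd n ((p ^ m - 1) / (p ^ ν - 1)) : ℝ) ≤
            c₁ * (n : ℝ) ^ ((119 : ℝ) / 605) *
              (Fintype.card F : ℝ) ^ (1 - (119 : ℝ) / 605) / (p : ℝ) ^ ν)
    (G : Subfield F) (hG : G ≠ ⊤) (H0 : Finset F)
    (h1 : H0 ⊆ powers F n) (h2 : ∀ h ∈ H0, h ∈ G) :
    (H0.card : ℝ) ≤ 2 * c₁ * ((powers F n).card : ℝ) ^ (1 - (119 : ℝ) / 605) := by
  have hcard := card_le_gcd hn G H0 h1 h2
  obtain ⟨ν, hGν, hνm, hνne⟩ := subfield_card hp hF G hG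
  rw [hGν] at hcard
  have hg := hgcd ν hνm hνne
  have hn0 : 0 < n := n_pos hn
  have hNn := card_powers hn
  have hN : 0 < (powers F n).card := Finset.card_pos.mpr ⟨1, (powers_grp n).one_mem⟩
  have hq1 := Fintype.one_lt_card (α := F)
  set N := (powers F n).card with hNdef
  have hPdvd : p ^ ν - 1 ∣ p ^ m - 1 := Nat.pow_sub_one_dvd_pow_sub_one p hνm
  have hkP : n * N = (p ^ m - 1) / (p ^ ν - 1) * (p ^ ν - 1) := by
    rw [Nat.div_mul_cancel hPdvd, hNn, hF]
  have hid := gcd_identity hN hkP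
  have hpν : (0 : ℝ) < (p : ℝ) ^ ν := by
    have : (0 : ℝ) < p := by exact_mod_cast hp.pos
    positivity
  set g := Nat.gcd n ((p ^ m - 1) / (p ^ ν - 1)) with hgdef
  have hidR : (n : ℝ) * (Nat.gcd N (p ^ ν - 1) : ℝ) ≤ (g : ℝ) * (p : ℝ) ^ ν := by
    have : n * Nat.gcd N (p ^ ν - 1) ≤ g * p ^ ν := by
      rw [← hid]; exact Nat.mul_le_mul_left _ (Nat.sub_le _ _)
    exact_mod_cast this
  rw [le_div_iff₀ hpν] at hg
  have hnR : (0 : ℝ) < n := by exact_mod_cast hn0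
  have hNR : (0 : ℝ) < N := by exact_mod_cast hN
  have hqR : (0 : ℝ) < Fintype.card F := by exact_mod_cast Fintype.card_pos
  have hq2 : (Fintype.card F : ℝ) ≤ n * (2 * N) := by
    have : Fintype.card F ≤ n * (2 * N) := by
      have : n * (2 * N) = 2 * (n * N) := by ring
      rw [this, hNn]; omega
    exact_mod_cast this
  have hd : (H0.card : ℝ) ≤ (Nat.gcd N (p ^ ν - 1) : ℝ) := by exact_mod_cast hcard
  have h2N : (0 : ℝ) ≤ 2 * N := by linarith
  have hexp : (119 : ℝ) / 605 + (1 - (119 : ℝ) / 605) = 1 := by norm_num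
  have h2e : (2 : ℝ) ^ (1 - (119 : ℝ) / 605) ≤ 2 := by
    calc (2 : ℝ) ^ (1 - (119 : ℝ) / 605) ≤ (2 : ℝ) ^ (1 : ℝ) :=
          Real.rpow_le_rpow_of_exponent_le (by norm_num) (by norm_num)
      _ = 2 := Real.rpow_one 2
  have h3 : (n : ℝ) * (H0.card : ℝ) ≤ n * (2 * c₁ * (N : ℝ) ^ (1 - (119 : ℝ) / 605)) := by
    calc (n : ℝ) * (H0.card : ℝ) ≤ n * (Nat.gcd N (p ^ ν - 1) : ℝ) := by gcongr
      _ ≤ c₁ * (n : ℝ) ^ ((119 : ℝ) / 605) * (Fintype.card F : ℝ) ^ (1 - (119 : ℝ) / 605) :=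
        hidR.trans hg
      _ ≤ c₁ * (n : ℝ) ^ ((119 : ℝ) / 605) * (n * (2 * N)) ^ (1 - (119 : ℝ) / 605) := by
        gcongr
      _ = c₁ * ((n : ℝ) ^ ((119 : ℝ) / 605) * (n : ℝ) ^ (1 - (119 : ℝ) / 605)) *
          ((2 : ℝ) ^ (1 - (119 : ℝ) / 605) * (N : ℝ) ^ (1 - (119 : ℝ) / 605)) := by
        rw [Real.mul_rpow hnR.le h2N, Real.mul_rpow zero_le_two hNR.le]; ring
      _ = c₁ * n * ((2 : ℝ) ^ (1 - (119 : ℝ) / 605) * (N : ℝ) ^ (1 - (119 : ℝ) / 605)) := by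
        rw [← Real.rpow_add hnR, hexp, Real.rpow_one]
      _ ≤ c₁ * n * (2 * (N : ℝ) ^ (1 - (119 : ℝ) / 605)) := by
        exact mul_le_mul_of_nonneg_left (mul_le_mul_of_nonneg_right h2e (Real.rpow_nonneg hNR.le _))
          (mul_nonneg hc.le hnR.le)
      _ = _ := by ring
  exact le_of_mul_le_mul_left h3 hnR

theorem final_contra {c₁ s N D h0 : ℝ} (hc : 0 < c₁) (hs : 0 < s) (hN : 1 ≤ N)
    (hD : (16 * c₁) ^ 84 < D) (h : D * N ^ 167 ≤ s ^ 168) (h1 : s ^ 2 ≤ 8 * N * h0)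
    (h2 : h0 ≤ 2 * c₁ * N ^ (1 - (119 : ℝ) / 605)) : False := by
  have hN0 : 0 < N := by linarith
  have h3 : s ^ 2 ≤ 16 * c₁ * (N * N ^ (1 - (119 : ℝ) / 605)) := by
    have := mul_le_mul_of_nonneg_left h2 (by positivity : 0 ≤ 8 * N)
    linarith
  have h4 : (N * N ^ (1 - (119 : ℝ) / 605)) ^ 84 ≤ N ^ 167 := by
    have e : N * N ^ (1 - (119 : ℝ) / 605) = N ^ (2 - (119 : ℝ) / 605) := by
      nth_rewrite 1 [← Real.rpow_one N]
      rw [← Real.rpow_add hN0]; norm_num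
    rw [e, ← Real.rpow_natCast, ← Real.rpow_natCast, ← Real.rpow_mul hN0.le]
    exact Real.rpow_le_rpow_of_exponent_le hN (by norm_num)
  have h5 : s ^ 168 ≤ (16 * c₁) ^ 84 * N ^ 167 := by
    calc s ^ 168 = (s ^ 2) ^ 84 := by ring
      _ ≤ (16 * c₁ * (N * N ^ (1 - (119 : ℝ) / 605))) ^ 84 := by gcongr
      _ = (16 * c₁) ^ 84 * (N * N ^ (1 - (119 : ℝ) / 605)) ^ 84 := by rw [mul_pow]
      _ ≤ _ := by gcongr
  have h6 : (16 * c₁) ^ 84 * N ^ 167 < D * N ^ 167 := by gcongr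
  linarith

theorem large_of_gt {q n N s B Z : ℝ} (hq : 1 ≤ q) (hn : 1 ≤ n) (hN : 0 < N) (hnN : n * N ≤ q)
    (hs : 0 ≤ s) (hB : 0 ≤ B) (hZ : Z ≤ 1 + n * s)
    (h : (B + 1) * (q ^ ((7 - 2 * ((1 : ℝ) / 56)) / 8) * n ^ ((2 + 2 * ((1 : ℝ) / 56)) / 8)) < Z) :
    B ^ 224 * q ^ 28 * N ^ 167 ≤ s ^ 224 := by
  set X := q ^ ((7 - 2 * ((1 : ℝ) / 56)) / 8) * n ^ ((2 + 2 * ((1 : ℝ) / 56)) / 8) with hX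
  have hq0 : 0 < q := by linarith
  have hn0 : 0 < n := by linarith
  have hX1 : 1 ≤ X := by
    have a := Real.one_le_rpow hq (by norm_num : (0 : ℝ) ≤ (7 - 2 * ((1 : ℝ) / 56)) / 8)
    have b := Real.one_le_rpow hn (by norm_num : (0 : ℝ) ≤ (2 + 2 * ((1 : ℝ) / 56)) / 8)
    rw [hX]
    nlinarith
  have h1 : B * X ≤ n * s := by nlinarith
  have hX224 : X ^ 224 = q ^ 195 * n ^ 57 := by
    rw [hX, mul_pow, ← Real.rpow_natCast, ← Real.rpow_natCast, ← Real.rpow_mul hq0.le,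
      ← Real.rpow_mul hn0.le, ← Real.rpow_natCast, ← Real.rpow_natCast]
    norm_num
  have h2 : B ^ 224 * (q ^ 195 * n ^ 57) ≤ n ^ 224 * s ^ 224 := by
    rw [← hX224, ← mul_pow, ← mul_pow]
    gcongr
  have h3 : B ^ 224 * q ^ 195 ≤ n ^ 167 * s ^ 224 := by
    have : n ^ 57 * (B ^ 224 * q ^ 195) ≤ n ^ 57 * (n ^ 167 * s ^ 224) := by
      calc n ^ 57 * (B ^ 224 * q ^ 195) = B ^ 224 * (q ^ 195 * n ^ 57) := by ring
        _ ≤ _ := h2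
        _ = _ := by ring
    exact le_of_mul_le_mul_left this (by positivity)
  have h4 : q ^ 167 * (B ^ 224 * q ^ 28 * N ^ 167) ≤ q ^ 167 * s ^ 224 := by
    calc q ^ 167 * (B ^ 224 * q ^ 28 * N ^ 167) = (B ^ 224 * q ^ 195) * N ^ 167 := by ring
      _ ≤ (n ^ 167 * s ^ 224) * N ^ 167 := by gcongr
      _ = (n * N) ^ 167 * s ^ 224 := by ring
      _ ≤ q ^ 167 * s ^ 224 :=
        mul_le_mul_of_nonneg_right (pow_le_pow_left₀ (by positivity) hnN 167) (pow_nonneg hs 224)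
  exact le_of_mul_le_mul_left h4 (by positivity)

theorem gauss_aux {c₁ B : ℝ} (hc : 0 < c₁) (hb2 : 2 ≤ B) (hb3 : 16 * c₁ < B) {p m n : ℕ} (hp : p.Prime)
    (hF : Fintype.card F = p ^ m) (hn : n ∣ Fintype.card F - 1)
    (hgcd : ∀ ν : ℕ, ν ∣ m → ν ≠ m →
          (Nat.gcd n ((p ^ m - 1) / (p ^ ν - 1)) : ℝ) ≤
            c₁ * (n : ℝ) ^ ((119 : ℝ) / 605) *
              (Fintype.card F : ℝ) ^ (1 - (119 : ℝ) / 605) / (p : ℝ) ^ ν)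
    (hψ : ψ ≠ 1) :
    ‖∑ x : F, ψ (x ^ n)‖ ≤ (B + 1) *
      ((Fintype.card F : ℝ) ^ ((7 - 2 * ((1 : ℝ) / 56)) / 8) *
        (n : ℝ) ^ ((2 + 2 * ((1 : ℝ) / 56)) / 8)) := by
  have hB0 : 0 ≤ B := by linarith
  have hBpos : 0 < B := by linarith
  by_contra! hlt
  have hH := powers_grp (F := F) n
  have hN := card_pos_of_grp _ hH
  have hN1 : (1 : ℝ) ≤ (powers F n).card := by exact_mod_cast hN
  have hq1 : (1 : ℝ) ≤ Fintype.card F := by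
    have := Fintype.one_lt_card (α := F)
    exact_mod_cast this.le
  have hqpos : (0 : ℝ) < Fintype.card F := q_pos
  have hn1 : (1 : ℝ) ≤ n := by exact_mod_cast n_pos hn
  have hnN : (n : ℝ) * (powers F n).card ≤ Fintype.card F := by
    have : n * (powers F n).card ≤ Fintype.card F := by rw [card_powers hn]; omega
    exact_mod_cast this
  have hZ : ‖∑ x : F, ψ (x ^ n)‖ ≤ 1 + n * ‖S ψ (powers F n) 1‖ := by
    rw [gauss_eq ψ hn]
    refine (norm_add_le _ _).trans ?_
    rw [norm_mul, norm_one, Complex.norm_natCast]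
  have hlarge := large_of_gt hq1 hn1 hN hnN (norm_nonneg _) hB0 hZ hlt
  have hD : (2 : ℝ) ^ 61 ≤ B ^ 224 :=
    calc (2 : ℝ) ^ 61 ≤ 2 ^ 224 := pow_le_pow_right₀ (by norm_num) (by norm_num)
      _ ≤ B ^ 224 := by gcongr
  have hD' : (16 * c₁) ^ 84 < B ^ 224 :=
    calc (16 * c₁) ^ 84 < B ^ 84 := by gcongr
      _ ≤ B ^ 224 := pow_le_pow_right₀ (by linarith only [hb2]) (by norm_num)
  have hs : S ψ (powers F n) 1 ≠ 0 := by
    intro h0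
    rw [h0, norm_zero, zero_pow (by norm_num)] at hlarge
    have : 0 < B ^ 224 * (Fintype.card F : ℝ) ^ 28 * ((powers F n).card : ℝ) ^ 167 := by
      positivity
    exact absurd hlarge (not_le.mpr this)
  have hs0 := norm_pos_iff.mpr hs
  obtain ⟨G, H0, hG, hH0, hH0G, h1⟩ := core_of_large ψ (powers F n) hψ hH hs hD hlarge
  have h2 := H0_bound hc hp hF hn hgcd G hG H0 hH0 hH0G
  have h3 := power_cond hs0 hN hqpos (by positivity)
    (norm_S_le ψ _ 1) (s_sq_le ψ _ hψ hH) hlarge 0 28 167 0 rfl rfl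
  rw [pow_zero, mul_one] at h3
  exact final_contra hc hs0 hN1 hD' h3 h1 h2

end GaussAux

/-- Theorem 4 (Gauss sums): if `n ∣ q - 1` and
`gcd(n, (p^m-1)/(p^ν-1)) ≪ n^δ q^{1-δ}/p^ν` for all proper divisors `ν` of `m`, with
`δ = 119/605`, then `|∑_x ψ(x^n)| ≪ q^{(7-2δ₂)/8} n^{(2+2δ₂)/8}`, `δ₂ = 1/56 + o(1)`. -/
theorem gauss_sum_bound :
    ∀ c₁ : ℝ, 0 < c₁ → ∃ C C' : ℝ, 0 < C ∧ 0 ≤ C' ∧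
      ∀ (F : Type) [Field F] [Fintype F] [DecidableEq F] (p m n : ℕ), p.Prime →
        Fintype.card F = p ^ m → n ∣ Fintype.card F - 1 →
        (∀ ν : ℕ, ν ∣ m → ν ≠ m →
          (Nat.gcd n ((p ^ m - 1) / (p ^ ν - 1)) : ℝ) ≤
            c₁ * (n : ℝ) ^ ((119 : ℝ) / 605) *
              (Fintype.card F : ℝ) ^ (1 - (119 : ℝ) / 605) / (p : ℝ) ^ ν) →
        ∀ ψ : AddChar F ℂ, ψ ≠ 1 →
          ‖∑ x : F, ψ (x ^ n)‖ ≤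
            C * (1 + Real.log (Fintype.card F)) ^ C' *
              (Fintype.card F : ℝ) ^ ((7 - 2 * ((1 : ℝ) / 56)) / 8) *
                (n : ℝ) ^ ((2 + 2 * ((1 : ℝ) / 56)) / 8) := by
  intro c₁ hc
  refine ⟨(2 + 16 * c₁) + 1, 0, by positivity, le_rfl, ?_⟩
  intro F _ _ _ p m n hp hF hn hgcd ψ hψ
  have h := GaussAux.gauss_aux ψ (B := 2 + 16 * c₁) hc (by linarith) (by linarith) hp hF hn hgcd hψ
  rw [Real.rpow_zero, mul_one, mul_assoc]
  exact h
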